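/- arXiv:1404.1273 — 8 statements merged into one kernel-verified Lean document; each statement's English description precedes it below -/
import Mathlib

section
/- Let X = (Ω, ℱ, ℙ, τ) be a metric dynamical system and V a potential on Ω. Then for every c ≥ 0 and every y ∈ ℝ^d one has Γ_V(c·y) = c·Γ_V(y). -/
open MeasureTheory Filter

noncomputable section

/-- `ℝ^d` with the Euclidean norm. -/
abbrev Rd (d : ℕ) := EuclideanSpace ℝ (Fin d)

variable {d : ℕ} {Ω : Type*} [MeasurableSpace Ω]

/-- The realisation `f_ω : ℝ^d → E`, `f_ω(x) = f(τ_x ω)`. -/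
def realise (τ : Rd d → Ω → Ω) {E : Type*} (f : Ω → E) (ω : Ω) : Rd d → E :=
  fun x => f (τ x ω)

/-- `(Ω, ℱ, ℙ, τ)` is a metric dynamical system: `ℙ` is a probability measure, `τ` is a
jointly measurable action of `(ℝ^d, +)` on `Ω` leaving `ℙ` invariant. -/
def IsMDS (P : Measure Ω) (τ : Rd d → Ω → Ω) : Prop :=
  IsProbabilityMeasure P ∧ Measurable (Function.uncurry τ) ∧
    (∀ x y ω, τ (x + y) ω = τ x (τ y ω)) ∧ (∀ ω, τ 0 ω = ω) ∧
    ∀ x, MeasurePreserving (τ x) P P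

/-- A potential: a nonnegative function in `L¹(ℙ)`. -/
def IsPotential (P : Measure Ω) (V : Ω → ℝ) : Prop :=
  Measurable V ∧ (∀ ω, 0 ≤ V ω) ∧ Integrable V P

/-- The space `𝔽`: probability densities `f ∈ L¹(ℙ)` with `𝔼f = 1`, bounded away from `0`,
all realisations smooth, and `sup_Ω |Dⁿf| < ∞` for all `n`. -/
def memF (P : Measure Ω) (τ : Rd d → Ω → Ω) (f : Ω → ℝ) : Prop :=
  Measurable f ∧ Integrable f P ∧ (∫ ω, f ω ∂P) = 1 ∧ (∃ c > 0, ∀ ω, c ≤ f ω) ∧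
    (∀ ω, ContDiff ℝ (⊤ : ℕ∞) (realise τ f ω)) ∧
    (∀ n : ℕ, ∃ C, ∀ ω, ‖iteratedFDeriv ℝ n (realise τ f ω) 0‖ ≤ C)

/-- The space `Φ_y`: vector fields `φ ∈ (L¹(ℙ))^d` with smooth realisations, all derivatives
uniformly bounded, `𝔼φ = y`, and divergence-free realisations. -/
def memPhi (P : Measure Ω) (τ : Rd d → Ω → Ω) (y : Rd d) (φ : Ω → Rd d) : Prop :=
  Measurable φ ∧ Integrable φ P ∧ (∫ ω, φ ω ∂P) = y ∧
    (∀ ω, ContDiff ℝ (⊤ : ℕ∞) (realise τ φ ω)) ∧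
    (∀ n : ℕ, ∃ C, ∀ ω, ‖iteratedFDeriv ℝ n (realise τ φ ω) 0‖ ≤ C) ∧
    (∀ ω x, (∑ i, fderiv ℝ (fun z => realise τ φ ω z i) x (EuclideanSpace.single i 1)) = 0)

/-- The energy term `∫ (|∇f|²/(8f) + Vf) dℙ`. -/
def energy (P : Measure Ω) (τ : Rd d → Ω → Ω) (V f : Ω → ℝ) : ℝ :=
  ∫ ω, (‖fderiv ℝ (realise τ f ω) 0‖ ^ 2 / (8 * f ω) + V ω * f ω) ∂P

/-- The transport term `inf_{φ ∈ Φ_y} ∫ |φ|²/(2f) dℙ`. -/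
def transport (P : Measure Ω) (τ : Rd d → Ω → Ω) (f : Ω → ℝ) (y : Rd d) : ℝ :=
  sInf {r | ∃ φ, memPhi P τ y φ ∧ r = ∫ ω, ‖φ ω‖ ^ 2 / (2 * f ω) ∂P}

/-- The variational functional
`Γ_V(y) = 2 inf_{f ∈ 𝔽} [ (∫ |∇f|²/(8f) + Vf dℙ) (inf_{φ ∈ Φ_y} ∫ |φ|²/(2f) dℙ) ]^{1/2}`. -/
def Gamma (P : Measure Ω) (τ : Rd d → Ω → Ω) (V : Ω → ℝ) (y : Rd d) : ℝ :=
  2 * sInf {r | ∃ f, memF P τ f ∧ r = Real.sqrt (energy P τ V f * transport P τ f y)}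

end

open scoped Pointwise

theorem memPhi_smul_aux {d : ℕ} {Ω : Type*} [MeasurableSpace Ω]
    (P : Measure Ω) (τ : Rd d → Ω → Ω) (c : ℝ) (y : Rd d) (φ : Ω → Rd d)
    (h : memPhi P τ y φ) : memPhi P τ (c • y) (fun ω => c • φ ω) := by
  obtain ⟨h1, h2, h3, h4, h5, h6⟩ := h
  have hr : ∀ ω, realise τ (fun ω => c • φ ω) ω = c • realise τ φ ω := fun ω => rfl
  refine ⟨h1.const_smul c, h2.smul c, ?_, ?_, ?_, ?_⟩
  · rw [integral_smul, h3]
  · intro ω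
    rw [hr]
    exact contDiff_const.smul (h4 ω)
  · intro n
    obtain ⟨C, hC⟩ := h5 n
    refine ⟨‖c‖ * C, fun ω => ?_⟩
    have hd : ContDiffAt ℝ n (realise τ φ ω) 0 :=
      ((h4 ω).of_le (by exact_mod_cast le_top)).contDiffAt
    rw [hr, iteratedFDeriv_const_smul_apply hd, norm_smul]
    exact mul_le_mul_of_nonneg_left (hC ω) (norm_nonneg c)
  · intro ω x
    have hd : ∀ i, DifferentiableAt ℝ (fun z => realise τ φ ω z i) x := by
      intro i
      have := ((h4 ω).differentiable (by simp)) x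
      exact (differentiableAt_euclidean.1 this) i
    have : ∀ i, fderiv ℝ (fun z => realise τ (fun ω => c • φ ω) ω z i) x
        = c • fderiv ℝ (fun z => realise τ φ ω z i) x := by
      intro i
      exact fderiv_const_smul (hd i) c
    simp only [this, ContinuousLinearMap.smul_apply, ← Finset.smul_sum, h6 ω x, smul_zero]

theorem memPhi_zero_aux {d : ℕ} {Ω : Type*} [MeasurableSpace Ω]
    (P : Measure Ω) (τ : Rd d → Ω → Ω) : memPhi P τ 0 (fun _ => 0) := by
  have hr : ∀ ω, realise τ (fun _ : Ω => (0 : Rd d)) ω = fun _ => 0 := fun ω => rfl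
  refine ⟨measurable_const, integrable_zero _ _ _, by simp, ?_, ?_, ?_⟩
  · intro ω
    rw [hr]
    exact contDiff_const
  · intro n
    refine ⟨0, fun ω => ?_⟩
    rw [hr]
    simp
  · intro ω x
    simp [hr]

theorem transport_smul_aux {d : ℕ} {Ω : Type*} [MeasurableSpace Ω]
    (P : Measure Ω) (τ : Rd d → Ω → Ω) (f : Ω → ℝ) (hf : memF P τ f)
    (c : ℝ) (y : Rd d) :
    transport P τ f (c • y) = c ^ 2 * transport P τ f y := by
  have key : ∀ (c : ℝ) (φ : Ω → Rd d), (∫ ω, ‖c • φ ω‖ ^ 2 / (2 * f ω) ∂P)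
      = c ^ 2 * ∫ ω, ‖φ ω‖ ^ 2 / (2 * f ω) ∂P := by
    intro c φ
    rw [← integral_const_mul]
    congr 1
    funext ω
    rw [norm_smul, mul_pow, Real.norm_eq_abs, sq_abs, mul_div_assoc]
  by_cases hc : c = 0
  · subst hc
    obtain ⟨k, hk, hkf⟩ := hf.2.2.2.1
    have : IsLeast {r | ∃ φ, memPhi P τ 0 φ ∧ r = ∫ ω, ‖φ ω‖ ^ 2 / (2 * f ω) ∂P} 0 := by
      refine ⟨⟨_, memPhi_zero_aux P τ, by simp⟩, ?_⟩
      rintro r ⟨φ, -, rfl⟩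
      refine integral_nonneg fun ω => ?_
      have : 0 ≤ f ω := hk.le.trans (hkf ω)
      positivity
    rw [zero_smul, transport, this.csInf_eq]
    simp
  · unfold transport
    rw [← smul_eq_mul, ← Real.sInf_smul_of_nonneg (sq_nonneg c)]
    congr 1
    ext r
    rw [Set.mem_smul_set]
    constructor
    · rintro ⟨φ, hφ, rfl⟩
      have h := memPhi_smul_aux P τ c⁻¹ _ φ hφ
      rw [inv_smul_smul₀ hc] at h
      refine ⟨_, ⟨_, h, rfl⟩, ?_⟩
      rw [key, smul_eq_mul, ← mul_assoc, ← mul_pow, mul_inv_cancel₀ hc, one_pow, one_mul]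
    · rintro ⟨_, ⟨φ, hφ, rfl⟩, rfl⟩
      exact ⟨_, memPhi_smul_aux P τ c _ φ hφ, by rw [key, smul_eq_mul]⟩

/-- positive homogeneity `Γ_V(c·y) = c·Γ_V(y)`. -/
theorem gamma_homogeneous {d : ℕ} {Ω : Type*} [MeasurableSpace Ω]
    (P : Measure Ω) (τ : Rd d → Ω → Ω) (hX : IsMDS P τ)
    (V : Ω → ℝ) (hV : IsPotential P V) (c : ℝ) (hc : 0 ≤ c) (y : Rd d) :
    Gamma P τ V (c • y) = c * Gamma P τ V y := by
  have hs : {r | ∃ f, memF P τ f ∧ r = Real.sqrt (energy P τ V f * transport P τ f (c • y))}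
      = c • {r | ∃ f, memF P τ f ∧ r = Real.sqrt (energy P τ V f * transport P τ f y)} := by
    have key : ∀ f, memF P τ f → Real.sqrt (energy P τ V f * transport P τ f (c • y))
        = c * Real.sqrt (energy P τ V f * transport P τ f y) := by
      intro f hf
      rw [transport_smul_aux P τ f hf, mul_left_comm, Real.sqrt_mul (sq_nonneg c),
        Real.sqrt_sq hc]
    ext r
    rw [Set.mem_smul_set]
    constructor
    · rintro ⟨f, hf, rfl⟩
      exact ⟨_, ⟨f, hf, rfl⟩, by rw [key f hf, smul_eq_mul]⟩
    · rintro ⟨_, ⟨f, hf, rfl⟩, rfl⟩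
      exact ⟨f, hf, by rw [key f hf, smul_eq_mul]⟩
  unfold Gamma
  rw [hs, Real.sInf_smul_of_nonneg hc, smul_eq_mul]
  ring
end

section
/- Let X = (Ω, ℱ, ℙ, τ) be a metric dynamical system and let the potential be the constant function c ≥ 0. Then for every y ∈ ℝ^d one has Γ_c(y) = √(2c)·|y|, where |y| is the Euclidean norm. -/
open MeasureTheory Filter

lemma aux_fderiv_meas {d : ℕ} {Ω : Type*} [MeasurableSpace Ω]
    (τ : Rd d → Ω → Ω) (hτ : Measurable (Function.uncurry τ)) (f : Ω → ℝ) (hf : Measurable f)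
    (hs : ∀ ω, ContDiff ℝ (⊤ : ℕ∞) (realise τ f ω)) :
    Measurable (fun ω => fderiv ℝ (realise τ f ω) 0) := by
  have hdir : ∀ v : Rd d, Measurable (fun ω => fderiv ℝ (realise τ f ω) 0 v) := by
    intro v
    have hm : ∀ x : Rd d, Measurable (fun ω => realise τ f ω x) := fun x =>
      hf.comp (hτ.comp (measurable_const.prodMk measurable_id))
    refine measurable_of_tendsto_metrizable
      (f := fun (n : ℕ) ω => ((n : ℝ) + 1) •
        (realise τ f ω (0 + ((n : ℝ) + 1)⁻¹ • v) - realise τ f ω 0)) ?_ ?_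
    · intro n
      exact Measurable.const_smul ((hm _).sub (hm _)) ((n : ℝ) + 1)
    · rw [tendsto_pi_nhds]
      intro ω
      have hd : HasFDerivAt (realise τ f ω) (fderiv ℝ (realise τ f ω) 0) 0 :=
        ((hs ω).differentiable (by simp) 0).hasFDerivAt
      have h := hd.lim_real v
      have h2 : Tendsto (fun n : ℕ => (n : ℝ) + 1) atTop atTop :=
        tendsto_atTop_add_const_right _ _ tendsto_natCast_atTop_atTop
      exact h.comp h2
  have heq : (fun ω => fderiv ℝ (realise τ f ω) 0) = fun ω =>
      ∑ i : Fin d, (fderiv ℝ (realise τ f ω) 0 (EuclideanSpace.single i 1)) •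
        (EuclideanSpace.proj i : Rd d →L[ℝ] ℝ) := by
    funext ω
    ext v
    have hv : v = ∑ i : Fin d, v i • (EuclideanSpace.single i (1 : ℝ) : Rd d) := by
      have := (EuclideanSpace.basisFun (Fin d) ℝ).sum_repr v
      simpa using this.symm
    conv_lhs => rw [hv]
    simp [map_sum, mul_comm]
  rw [heq]
  exact Finset.measurable_sum _ (fun i _ => (hdir _).smul_const _)

lemma aux_energy {d : ℕ} {Ω : Type*} [MeasurableSpace Ω]
    (P : Measure Ω) (τ : Rd d → Ω → Ω) (hX : IsMDS P τ)
    (c : ℝ) (f : Ω → ℝ) (hf : memF P τ f) : c ≤ energy P τ (fun _ => c) f := by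
  obtain ⟨hP, hτ, -, -, -⟩ := hX
  obtain ⟨hm, hi, h1, ⟨a, ha, hfa⟩, hs, hb⟩ := hf
  obtain ⟨C, hC⟩ := hb 1
  have hpos : ∀ ω, 0 < f ω := fun ω => ha.trans_le (hfa ω)
  have hint : Integrable (fun ω => ‖fderiv ℝ (realise τ f ω) 0‖ ^ 2 / (8 * f ω)) P := by
    refine Integrable.of_bound (C := C ^ 2 / (8 * a)) ?_ (Eventually.of_forall fun ω => ?_)
    · exact (((aux_fderiv_meas τ hτ f hm hs).norm.pow_const 2).div
        (hm.const_mul 8)).aestronglyMeasurable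
    · have h := hC ω
      rw [norm_iteratedFDeriv_one] at h
      have := hpos ω
      rw [Real.norm_of_nonneg (by positivity)]
      have := hfa ω
      gcongr
  unfold energy
  rw [integral_add hint (hi.const_mul c), integral_const_mul, h1]
  have : 0 ≤ ∫ ω, ‖fderiv ℝ (realise τ f ω) 0‖ ^ 2 / (8 * f ω) ∂P :=
    integral_nonneg fun ω => by
      have := hpos ω
      positivity
  linarith

lemma aux_phi {d : ℕ} {Ω : Type*} [MeasurableSpace Ω]
    (P : Measure Ω) (τ : Rd d → Ω → Ω) (hX : IsMDS P τ) (y : Rd d)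
    (f : Ω → ℝ) (hf : memF P τ f) (φ : Ω → Rd d) (hφ : memPhi P τ y φ) :
    ‖y‖ ^ 2 / 2 ≤ ∫ ω, ‖φ ω‖ ^ 2 / (2 * f ω) ∂P := by
  obtain ⟨hP, hτ, -, h0, -⟩ := hX
  obtain ⟨hm, hi, h1, ⟨a, ha, hfa⟩, -, -⟩ := hf
  obtain ⟨hpm, hpi, hpy, -, hb, -⟩ := hφ
  obtain ⟨C, hC⟩ := hb 0
  have hpos : ∀ ω, 0 < f ω := fun ω => ha.trans_le (hfa ω)
  have hint : Integrable (fun ω => ‖φ ω‖ ^ 2 / (2 * f ω)) P := by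
    refine Integrable.of_bound (C := C ^ 2 / (2 * a)) ?_ (Eventually.of_forall fun ω => ?_)
    · exact ((hpm.norm.pow_const 2).div (hm.const_mul 2)).aestronglyMeasurable
    · have h := hC ω
      rw [norm_iteratedFDeriv_zero] at h
      simp only [realise, h0] at h
      have := hpos ω
      rw [Real.norm_of_nonneg (by positivity)]
      have := hfa ω
      gcongr
  have hle : ∫ ω, (‖y‖ * ‖φ ω‖ - ‖y‖ ^ 2 / 2 * f ω) ∂P ≤ ∫ ω, ‖φ ω‖ ^ 2 / (2 * f ω) ∂P := by
    refine integral_mono ((hpi.norm.const_mul _).sub (hi.const_mul _)) hint fun ω => ?_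
    have := hpos ω
    simp only
    rw [le_div_iff₀ (by positivity)]
    nlinarith [sq_nonneg (‖φ ω‖ - ‖y‖ * f ω)]
  rw [integral_sub (hpi.norm.const_mul _) (hi.const_mul _), integral_const_mul,
    integral_const_mul, h1] at hle
  have hn : ‖y‖ ≤ ∫ ω, ‖φ ω‖ ∂P := by
    rw [← hpy]
    exact norm_integral_le_integral_norm _
  nlinarith [mul_le_mul_of_nonneg_left hn (norm_nonneg y)]

lemma aux_const_phi {d : ℕ} {Ω : Type*} [MeasurableSpace Ω]
    (P : Measure Ω) (τ : Rd d → Ω → Ω) (hX : IsMDS P τ) (y : Rd d) :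
    memPhi P τ y (fun _ => y) := by
  have := hX.1
  refine ⟨measurable_const, integrable_const _, by simp, fun ω => contDiff_const, fun n =>
    ⟨‖iteratedFDeriv ℝ n (fun _ : Rd d => y) 0‖, fun ω => le_rfl⟩, fun ω x => ?_⟩
  simp [realise]

lemma aux_const_f {d : ℕ} {Ω : Type*} [MeasurableSpace Ω]
    (P : Measure Ω) (τ : Rd d → Ω → Ω) (hX : IsMDS P τ) :
    memF P τ (fun _ => 1) := by
  have := hX.1
  exact ⟨measurable_const, integrable_const _, by simp, ⟨1, one_pos, fun _ => le_rfl⟩,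
    fun ω => contDiff_const, fun n =>
    ⟨‖iteratedFDeriv ℝ n (fun _ : Rd d => (1 : ℝ)) 0‖, fun ω => le_rfl⟩⟩

lemma aux_transport {d : ℕ} {Ω : Type*} [MeasurableSpace Ω]
    (P : Measure Ω) (τ : Rd d → Ω → Ω) (hX : IsMDS P τ) (y : Rd d)
    (f : Ω → ℝ) (hf : memF P τ f) : ‖y‖ ^ 2 / 2 ≤ transport P τ f y := by
  refine le_csInf ⟨_, _, aux_const_phi P τ hX y, rfl⟩ ?_
  rintro r ⟨φ, hφ, rfl⟩
  exact aux_phi P τ hX y f hf φ hφ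

/-- for the constant potential `c ≥ 0`, `Γ_c(y) = √(2c)·|y|`. -/
theorem gamma_const {d : ℕ} {Ω : Type*} [MeasurableSpace Ω]
    (P : Measure Ω) (τ : Rd d → Ω → Ω) (hX : IsMDS P τ)
    (c : ℝ) (hc : 0 ≤ c) (y : Rd d) :
    Gamma P τ (fun _ => c) y = Real.sqrt (2 * c) * ‖y‖ := by
  have := hX.1
  have hsq : Real.sqrt (2 * c) * ‖y‖ = 2 * Real.sqrt (c * (‖y‖ ^ 2 / 2)) := by
    rw [show (2 : ℝ) * Real.sqrt (c * (‖y‖ ^ 2 / 2))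
      = Real.sqrt (2 ^ 2) * Real.sqrt (c * (‖y‖ ^ 2 / 2)) by
        rw [Real.sqrt_sq (by norm_num)], ← Real.sqrt_mul (by norm_num)]
    rw [show (2 : ℝ) ^ 2 * (c * (‖y‖ ^ 2 / 2)) = 2 * c * ‖y‖ ^ 2 by ring,
      Real.sqrt_mul (by positivity : (0 : ℝ) ≤ 2 * c), Real.sqrt_sq (norm_nonneg y)]
  rw [hsq]
  unfold Gamma
  congr 1
  refine IsLeast.csInf_eq ⟨⟨fun _ => 1, aux_const_f P τ hX, ?_⟩, ?_⟩
  · have he : energy P τ (fun _ => c) (fun _ => 1) = c := by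
      have hr : ∀ ω, realise τ (fun _ : Ω => (1 : ℝ)) ω = fun _ => 1 := fun ω => rfl
      simp [energy, hr]
    have ht : transport P τ (fun _ => 1) y = ‖y‖ ^ 2 / 2 := by
      refine IsLeast.csInf_eq ⟨⟨_, aux_const_phi P τ hX y, by simp⟩, ?_⟩
      rintro r ⟨φ, hφ, rfl⟩
      exact aux_phi P τ hX y _ (aux_const_f P τ hX) φ hφ
    rw [he, ht]
  · rintro r ⟨f, hf, rfl⟩
    have h1 := aux_energy P τ hX c f hf
    have h2 := aux_transport P τ hX y f hf
    apply Real.sqrt_le_sqrt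
    exact mul_le_mul h1 h2 (by positivity) (hc.trans h1)
end

section
/- Let X = (Ω, ℱ, ℙ, τ) be a metric dynamical system, let λ_1, …, λ_k be positive real numbers with λ_1 + … + λ_k = 1, and let V_1, …, V_k be potentials on Ω. Then for every y ∈ ℝ^d one has Γ_{λ_1 V_1 + … + λ_k V_k}(y)² ≥ λ_1 Γ_{V_1}(y)² + … + λ_k Γ_{V_k}(y)², and in particular Γ_{λ_1 V_1 + … + λ_k V_k}(y) ≥ λ_1 Γ_{V_1}(y) + … + λ_k Γ_{V_k}(y). -/
open MeasureTheory Filter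

theorem aux_energy_nonneg {d : ℕ} {Ω : Type*} [MeasurableSpace Ω]
    (P : Measure Ω) (τ : Rd d → Ω → Ω) (V f : Ω → ℝ) (hV : ∀ ω, 0 ≤ V ω)
    (hf : memF P τ f) : 0 ≤ energy P τ V f := by
  obtain ⟨c, hc, hcf⟩ := hf.2.2.2.1
  refine integral_nonneg fun ω => ?_
  have h1 : 0 < f ω := lt_of_lt_of_le hc (hcf ω)
  have h2 := hV ω
  simp only [Pi.zero_apply]
  positivity

theorem aux_transport_nonneg {d : ℕ} {Ω : Type*} [MeasurableSpace Ω]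
    (P : Measure Ω) (τ : Rd d → Ω → Ω) (f : Ω → ℝ) (y : Rd d)
    (hf : memF P τ f) : 0 ≤ transport P τ f y := by
  obtain ⟨c, hc, hcf⟩ := hf.2.2.2.1
  refine Real.sInf_nonneg ?_
  rintro r ⟨φ, -, rfl⟩
  refine integral_nonneg fun ω => ?_
  have h1 : 0 < f ω := lt_of_lt_of_le hc (hcf ω)
  simp only [Pi.zero_apply]
  positivity

theorem aux_Gamma_nonneg {d : ℕ} {Ω : Type*} [MeasurableSpace Ω]
    (P : Measure Ω) (τ : Rd d → Ω → Ω) (V : Ω → ℝ) (y : Rd d) : 0 ≤ Gamma P τ V y := by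
  refine mul_nonneg (by norm_num) (Real.sInf_nonneg ?_)
  rintro r ⟨f, -, rfl⟩
  exact Real.sqrt_nonneg _

theorem aux_Gamma_sq_le {d : ℕ} {Ω : Type*} [MeasurableSpace Ω]
    (P : Measure Ω) (τ : Rd d → Ω → Ω) (V f : Ω → ℝ) (y : Rd d) (hV : ∀ ω, 0 ≤ V ω)
    (hf : memF P τ f) : Gamma P τ V y ^ 2 ≤ 4 * (energy P τ V f * transport P τ f y) := by
  have h0 := mul_nonneg (aux_energy_nonneg P τ V f hV hf) (aux_transport_nonneg P τ f y hf)
  have h1 : Gamma P τ V y ≤ 2 * Real.sqrt (energy P τ V f * transport P τ f y) := by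
    refine mul_le_mul_of_nonneg_left (csInf_le ⟨0, ?_⟩ ⟨f, hf, rfl⟩) (by norm_num)
    rintro r ⟨f, -, rfl⟩
    exact Real.sqrt_nonneg _
  have h2 := pow_le_pow_left₀ (aux_Gamma_nonneg P τ V y) h1 2
  rw [mul_pow, Real.sq_sqrt h0] at h2
  linarith

/-- If the gradient term is not integrable, both sides vanish, so no measurability of the
gradient is needed. -/
theorem aux_energy_sum {d : ℕ} {Ω : Type*} [MeasurableSpace Ω]
    (P : Measure Ω) (τ : Rd d → Ω → Ω) (hX : IsMDS P τ)
    (k : ℕ) (lam : Fin k → ℝ) (hsum : (∑ i, lam i) = 1)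
    (Vs : Fin k → Ω → ℝ) (hVs : ∀ i, IsPotential P (Vs i)) (f : Ω → ℝ) (hf : memF P τ f) :
    energy P τ (fun ω => ∑ i, lam i * Vs i ω) f = ∑ i, lam i * energy P τ (Vs i) f := by
  obtain ⟨C, hC⟩ := hf.2.2.2.2.2 0
  have hb : ∀ ω, ‖f ω‖ ≤ C := fun ω => by
    have := hC ω
    rwa [norm_iteratedFDeriv_zero, realise, hX.2.2.2.1 ω] at this
  have hint : ∀ i, Integrable (fun ω => Vs i ω * f ω) P := fun i =>
    (hVs i).2.2.mul_bdd hf.1.aestronglyMeasurable (Eventually.of_forall hb)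
  have heq : (fun ω => (∑ i, lam i * Vs i ω) * f ω) =
      fun ω => ∑ i, lam i * (Vs i ω * f ω) := by
    funext ω
    rw [Finset.sum_mul]
    exact Finset.sum_congr rfl fun i _ => by ring
  have hintS : Integrable (fun ω => (∑ i, lam i * Vs i ω) * f ω) P := by
    rw [heq]
    exact integrable_finsetSum _ fun i _ => (hint i).const_mul _
  unfold energy
  by_cases hg : Integrable (fun ω => ‖fderiv ℝ (realise τ f ω) 0‖ ^ 2 / (8 * f ω)) P
  · rw [integral_add hg hintS]
    simp_rw [integral_add hg (hint _), mul_add]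
    rw [Finset.sum_add_distrib, ← Finset.sum_mul, hsum, one_mul, heq,
      integral_finsetSum _ fun i _ => (hint i).const_mul _]
    simp_rw [integral_const_mul]
  · have key : ∀ W : Ω → ℝ, Integrable (fun ω => W ω * f ω) P →
        (∫ ω, (‖fderiv ℝ (realise τ f ω) 0‖ ^ 2 / (8 * f ω) + W ω * f ω) ∂P) = 0 := by
      intro W hW
      refine integral_undef fun h => hg ?_
      have := h.sub hW
      refine this.congr (Eventually.of_forall fun ω => ?_)
      simp
    rw [key _ hintS]
    simp_rw [fun i => key _ (hint i)]
    simp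

/-- concavity of `Γ` (squared and non-squared form) for convex combinations of
potentials. -/
theorem gamma_concave {d : ℕ} {Ω : Type*} [MeasurableSpace Ω]
    (P : Measure Ω) (τ : Rd d → Ω → Ω) (hX : IsMDS P τ)
    (k : ℕ) (lam : Fin k → ℝ) (hpos : ∀ i, 0 < lam i) (hsum : (∑ i, lam i) = 1)
    (Vs : Fin k → Ω → ℝ) (hVs : ∀ i, IsPotential P (Vs i)) (y : Rd d) :
    (∑ i, lam i * (Gamma P τ (Vs i) y) ^ 2) ≤
        (Gamma P τ (fun ω => ∑ i, lam i * Vs i ω) y) ^ 2 ∧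
    (∑ i, lam i * Gamma P τ (Vs i) y) ≤
        Gamma P τ (fun ω => ∑ i, lam i * Vs i ω) y := by
  have hJ : (∑ i, lam i * Gamma P τ (Vs i) y) ^ 2 ≤ ∑ i, lam i * (Gamma P τ (Vs i) y) ^ 2 :=
    Real.pow_arith_mean_le_arith_mean_pow _ _ _ (fun i _ => (hpos i).le) hsum
      (fun i _ => aux_Gamma_nonneg P τ (Vs i) y) 2
  have main : (∑ i, lam i * (Gamma P τ (Vs i) y) ^ 2) ≤
      (Gamma P τ (fun ω => ∑ i, lam i * Vs i ω) y) ^ 2 := by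
    by_cases hne : ∃ f, memF P τ f
    · have hS : 0 ≤ ∑ i, lam i * (Gamma P τ (Vs i) y) ^ 2 :=
        Finset.sum_nonneg fun i _ => mul_nonneg (hpos i).le (sq_nonneg _)
      have hle : Real.sqrt (∑ i, lam i * (Gamma P τ (Vs i) y) ^ 2) ≤
          Gamma P τ (fun ω => ∑ i, lam i * Vs i ω) y := by
        rw [Gamma, ← div_le_iff₀' (by norm_num : (0 : ℝ) < 2)]
        obtain ⟨f₀, hf₀⟩ := hne
        refine le_csInf ⟨_, f₀, hf₀, rfl⟩ ?_
        rintro r ⟨f, hf, rfl⟩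
        apply Real.le_sqrt_of_sq_le
        rw [div_pow, Real.sq_sqrt hS, aux_energy_sum P τ hX k lam hsum Vs hVs f hf,
          div_le_iff₀ (by norm_num), Finset.sum_mul, Finset.sum_mul]
        refine Finset.sum_le_sum fun i _ => ?_
        have := mul_le_mul_of_nonneg_left
          (aux_Gamma_sq_le P τ (Vs i) f y (hVs i).2.1 hf) (hpos i).le
        linarith
      have := pow_le_pow_left₀ (Real.sqrt_nonneg _) hle 2
      rwa [Real.sq_sqrt hS] at this
    · have hz : ∀ V, Gamma P τ V y = 0 := by
        intro V
        have : {r | ∃ f, memF P τ f ∧ r = Real.sqrt (energy P τ V f * transport P τ f y)} = ∅ := by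
          ext r
          simp only [Set.mem_ofPred_eq, Set.mem_empty_iff_false, iff_false]
          rintro ⟨f, hf, -⟩
          exact hne ⟨f, hf⟩
        rw [Gamma, this, Real.sInf_empty, mul_zero]
      simp [hz]
  exact ⟨main, (le_abs_self _).trans (abs_le_of_sq_le_sq (hJ.trans main) (aux_Gamma_nonneg _ _ _ _))⟩
end

section
/- Let X = (Ω, ℱ, ℙ, τ) be a metric dynamical system and V a potential on Ω, and set σ_s(0) := inf_{f ∈ 𝔽} 𝔼[ |∇f|²/(8f) + Vf ]. Then for every y ∈ ℝ^d with y ≠ 0 one has Γ_V(y/|y|)² ≥ 2·σ_s(0). -/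
open MeasureTheory Filter

theorem transport_ge_half {d : ℕ} {Ω : Type*} [MeasurableSpace Ω]
    (P : Measure Ω) (τ : Rd d → Ω → Ω) (hX : IsMDS P τ) (f : Ω → ℝ) (hf : memF P τ f)
    (y : Rd d) (hy : ‖y‖ = 1) : 1 / 2 ≤ transport P τ f y := by
  obtain ⟨hP, -, -, h0, -⟩ := hX
  obtain ⟨hfm, hfi, hf1, ⟨c, hc, hcf⟩, -, -⟩ := hf
  refine le_csInf ⟨_, fun _ => y, ⟨measurable_const, integrable_const _, by simp, ?_, ?_, ?_⟩, rfl⟩ ?_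
  · intro ω
    exact contDiff_const
  · intro n
    exact ⟨‖iteratedFDeriv ℝ n (fun _ : Rd d => y) 0‖, fun ω => le_rfl⟩
  · intro ω x
    simp [realise]
  · rintro r ⟨φ, ⟨hm, hi, hE, -, hb, -⟩, rfl⟩
    obtain ⟨C, hC⟩ := hb 0
    have hC' : ∀ ω, ‖φ ω‖ ≤ C := fun ω => by
      have := hC ω
      rw [norm_iteratedFDeriv_zero] at this
      simpa [realise, h0] using this
    have hint : Integrable (fun ω => ‖φ ω‖ ^ 2 / (2 * f ω)) P := by
      refine Integrable.of_bound (C := C ^ 2 / (2 * c))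
        ((hm.norm.pow_const 2).div (hfm.const_mul 2)).aestronglyMeasurable
        (Eventually.of_forall fun ω => ?_)
      have h1 := hcf ω
      have h2 : 0 < f ω := lt_of_lt_of_le hc h1
      rw [Real.norm_of_nonneg (by positivity)]
      have := hC' ω
      gcongr
    have key : ∫ ω, ‖φ ω‖ ∂P ≤ ∫ ω, (‖φ ω‖ ^ 2 / (2 * f ω) + f ω / 2) ∂P := by
      refine integral_mono hi.norm (hint.add (hfi.div_const 2)) fun ω => ?_
      have h2 : 0 < f ω := lt_of_lt_of_le hc (hcf ω)
      have : ‖φ ω‖ ^ 2 / (2 * f ω) + f ω / 2 - ‖φ ω‖ = (‖φ ω‖ - f ω) ^ 2 / (2 * f ω) := by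
        field_simp
        ring
      have h3 : 0 ≤ (‖φ ω‖ - f ω) ^ 2 / (2 * f ω) := by positivity
      show ‖φ ω‖ ≤ ‖φ ω‖ ^ 2 / (2 * f ω) + f ω / 2
      linarith
    rw [integral_add hint (hfi.div_const 2), integral_div, hf1] at key
    have := norm_integral_le_integral_norm (μ := P) φ
    rw [hE, hy] at this
    linarith

/-- `Γ_V(y/|y|)² ≥ 2·σ_s(0)` where
`σ_s(0) = inf_{f ∈ 𝔽} 𝔼[|∇f|²/(8f) + Vf]`. -/
theorem gamma_ge_qfe {d : ℕ} {Ω : Type*} [MeasurableSpace Ω]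
    (P : Measure Ω) (τ : Rd d → Ω → Ω) (hX : IsMDS P τ)
    (V : Ω → ℝ) (hV : IsPotential P V) (y : Rd d) (hy : y ≠ 0) :
    2 * sInf {r | ∃ f, memF P τ f ∧ r = energy P τ V f} ≤
      (Gamma P τ V (‖y‖⁻¹ • y)) ^ 2 := by
  classical
  have hy1 : ‖‖y‖⁻¹ • y‖ = 1 := by
    rw [norm_smul, norm_inv, norm_norm, inv_mul_cancel₀ (norm_ne_zero_iff.mpr hy)]
  have hen : ∀ f, memF P τ f → 0 ≤ energy P τ V f := by
    rintro f ⟨-, -, -, ⟨c, hc, hcf⟩, -, -⟩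
    refine integral_nonneg fun ω => ?_
    have h2 : 0 < f ω := lt_of_lt_of_le hc (hcf ω)
    have h3 := hV.2.1 ω
    show 0 ≤ ‖fderiv ℝ (realise τ f ω) 0‖ ^ 2 / (8 * f ω) + V ω * f ω
    positivity
  set S := sInf {r | ∃ f, memF P τ f ∧ r = energy P τ V f} with hS
  have hS0 : 0 ≤ S := Real.sInf_nonneg (by rintro r ⟨f, hf, rfl⟩; exact hen f hf)
  by_cases hne : ∃ f, memF P τ f
  · obtain ⟨f₀, hf₀⟩ := hne
    have hle : Real.sqrt (S / 2) ≤ sInf {r | ∃ f, memF P τ f ∧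
        r = Real.sqrt (energy P τ V f * transport P τ f (‖y‖⁻¹ • y))} := by
      refine le_csInf ⟨_, f₀, hf₀, rfl⟩ ?_
      rintro r ⟨f, hf, rfl⟩
      apply Real.sqrt_le_sqrt
      have h1 : S ≤ energy P τ V f :=
        csInf_le ⟨0, by rintro r ⟨g, hg, rfl⟩; exact hen g hg⟩ ⟨f, hf, rfl⟩
      have h2 := transport_ge_half P τ hX f hf _ hy1
      have h3 := hen f hf
      nlinarith
    have h4 := pow_le_pow_left₀ (Real.sqrt_nonneg _) hle 2
    rw [Real.sq_sqrt (by positivity)] at h4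
    rw [Gamma, mul_pow]
    linarith
  · have : S = 0 := by
      rw [hS]
      convert Real.sInf_empty
      ext r
      simp only [Set.mem_setOf_eq, Set.mem_empty_iff_false, iff_false]
      rintro ⟨f, hf, -⟩
      exact hne ⟨f, hf⟩
    rw [this]
    nlinarith [sq_nonneg (Gamma P τ V (‖y‖⁻¹ • y))]
end

section
/- Let (Ω, ℱ, ℙ) be a probability space, let f : Ω → ℝ be measurable with 𝔼f = 1 and f ≥ c_f ℙ-a.s. for some constant c_f > 0, and let φ = (φ_1, …, φ_d) : Ω → ℝ^d be integrable with 𝔼φ = y for some y ∈ ℝ^d. Then ∫ |φ|²/(2f) dℙ ≥ |y|²/2, where |·| is the Euclidean norm on ℝ^d. -/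
open MeasureTheory Filter

/-- the lower bound `∫ |φ|²/(2f) dℙ ≥ |y|²/2` (interpreted in `[0,∞]`) for a
probability density `f` bounded below and an integrable vector field `φ` with mean `y`. -/
theorem transport_lower_bound {d : ℕ} {Ω : Type*} [MeasurableSpace Ω]
    (P : Measure Ω) [IsProbabilityMeasure P]
    (f : Ω → ℝ) (hfm : Measurable f) (hfi : Integrable f P)
    (hf1 : (∫ ω, f ω ∂P) = 1)
    (cf : ℝ) (hcf : 0 < cf) (hflb : ∀ᵐ ω ∂P, cf ≤ f ω)
    (φ : Ω → Rd d) (hφ : Integrable φ P) (y : Rd d) (hφy : (∫ ω, φ ω ∂P) = y) :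
    ENNReal.ofReal (‖y‖ ^ 2 / 2) ≤ ∫⁻ ω, ENNReal.ofReal (‖φ ω‖ ^ 2 / (2 * f ω)) ∂P := by
  have hg : Integrable (fun ω => ‖y‖ * ‖φ ω‖ - ‖y‖ ^ 2 / 2 * f ω) P :=
    (hφ.norm.const_mul _).sub (hfi.const_mul _)
  have h1 : ‖y‖ ≤ ∫ ω, ‖φ ω‖ ∂P := by
    rw [← hφy]; exact norm_integral_le_integral_norm _
  have h2 : ‖y‖ ^ 2 / 2 ≤ ∫ ω, (‖y‖ * ‖φ ω‖ - ‖y‖ ^ 2 / 2 * f ω) ∂P := by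
    rw [integral_sub (hφ.norm.const_mul _) (hfi.const_mul _), integral_const_mul,
      integral_const_mul, hf1]
    nlinarith [mul_le_mul_of_nonneg_left h1 (norm_nonneg y)]
  have h3 : (∫ ω, (‖y‖ * ‖φ ω‖ - ‖y‖ ^ 2 / 2 * f ω) ∂P)
      ≤ ∫ ω, max (‖y‖ * ‖φ ω‖ - ‖y‖ ^ 2 / 2 * f ω) 0 ∂P :=
    integral_mono hg hg.pos_part (fun ω => le_max_left _ _)
  refine (ENNReal.ofReal_le_ofReal (h2.trans h3)).trans ?_
  rw [ofReal_integral_eq_lintegral_ofReal hg.pos_part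
    (Eventually.of_forall fun ω => le_max_right _ _)]
  refine lintegral_mono_ae ?_
  filter_upwards [hflb] with ω hω
  have hf : 0 < f ω := hcf.trans_le hω
  refine ENNReal.ofReal_le_ofReal (max_le ?_ (by positivity))
  rw [le_div_iff₀ (by positivity)]
  nlinarith [sq_nonneg (‖φ ω‖ - ‖y‖ * f ω)]
end

section
/- Let X = (Ω, ℱ, ℙ, τ) be a metric dynamical system and V a potential which is nondeterministic (not ℙ-a.s. equal to a constant), weakly differentiable with ‖∇V‖_∞ < ∞, and satisfies 0 < v_min ≤ V ≤ v_max < ∞ for constants v_min, v_max. Then for every y ∈ ℝ^d with y ≠ 0 one has the strict inequality Γ_V(y) < Γ_{𝔼V}(y), where 𝔼V denotes the constant potential equal to the mean of V (so Γ_{𝔼V}(y) = √(2𝔼V)·|y|). -/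
open MeasureTheory Filter

open scoped Convolution Topology

/-- derivative bounds for convolutions, uniform in the bounded function. -/
theorem conv_bound {d : ℕ} (M : ℝ) (n : ℕ) : ∀ {E : Type} [NormedAddCommGroup E] [NormedSpace ℝ E]
    [CompleteSpace E]
    (ρ : Rd d → E), HasCompactSupport ρ → ContDiff ℝ (⊤ : ℕ∞) ρ →
    ∃ C, ∀ g : Rd d → ℝ, Measurable g → (∀ x, ‖g x‖ ≤ M) → ∀ x,
      ‖iteratedFDeriv ℝ n (g ⋆[ContinuousLinearMap.lsmul ℝ ℝ, volume] ρ) x‖ ≤ C := by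
  induction n with
  | zero =>
    intro E _ _ _ ρ hc hs
    have hi : Integrable ρ volume := hs.continuous.integrable_of_hasCompactSupport hc
    refine ⟨∫ t, M * ‖ρ t‖, fun g hg hb x => ?_⟩
    rw [norm_iteratedFDeriv_zero, convolution_def]
    calc _ ≤ ∫ t, M * ‖ρ (x - t)‖ := by
          refine norm_integral_le_of_norm_le ((hi.norm.const_mul M).comp_sub_left x) ?_
          refine Eventually.of_forall fun t => ?_
          simp only [ContinuousLinearMap.lsmul_apply, norm_smul]
          exact mul_le_mul_of_nonneg_right (hb t) (norm_nonneg _)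
      _ = _ := integral_sub_left_eq_self (fun t => M * ‖ρ t‖) volume x
  | succ n ih =>
    intro E _ _ _ ρ hc hs
    obtain ⟨C, hC⟩ := ih (fderiv ℝ ρ) (hc.fderiv ℝ) (hs.fderiv_right (m := (⊤ : ℕ∞)) (by simp))
    refine ⟨C, fun g hg hb x => ?_⟩
    have hli : LocallyIntegrable g volume := by
      refine (locallyIntegrable_const M).mono hg.aestronglyMeasurable ?_
      exact Eventually.of_forall fun t => (hb t).trans (le_abs_self M)
    have key : fderiv ℝ (g ⋆[ContinuousLinearMap.lsmul ℝ ℝ, volume] ρ) =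
        (g ⋆[ContinuousLinearMap.lsmul ℝ ℝ, volume] (fderiv ℝ ρ)) := by
      funext z
      rw [(hc.hasFDerivAt_convolution_right (ContinuousLinearMap.lsmul ℝ ℝ) hli
        (hs.of_le (by exact_mod_cast le_top)) z).fderiv]
      rfl
    rw [← norm_iteratedFDeriv_fderiv, key]
    exact hC g hg hb x

theorem fderiv_sm {d : ℕ} {Ω : Type*} [MeasurableSpace Ω] {τ : Rd d → Ω → Ω}
    (hτ : Measurable (Function.uncurry τ)) (h0 : ∀ ω, τ 0 ω = ω) {f : Ω → ℝ} (hf : Measurable f)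
    (hs : ∀ ω, ContDiff ℝ (⊤ : ℕ∞) (realise τ f ω)) :
    StronglyMeasurable (fun ω => fderiv ℝ (realise τ f ω) 0) := by
  have hx : ∀ x, Measurable (τ x) := fun x => hτ.comp measurable_prodMk_left
  have e : (fun ω => fderiv ℝ (realise τ f ω) 0) = fun ω => ∑ i : Fin d,
      (fderiv ℝ (realise τ f ω) 0 (EuclideanSpace.single i 1)) •
        (EuclideanSpace.proj i : Rd d →L[ℝ] ℝ) := by
    funext ω
    ext v
    have hv : v = ∑ i, v i • EuclideanSpace.single i (1:ℝ) := by
      ext j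
      simp [Pi.single_apply]
    conv_lhs => rw [hv]
    rw [map_sum, sum_apply]
    refine Finset.sum_congr rfl fun i _ => ?_
    simp [mul_comm]
  rw [e]
  refine Finset.stronglyMeasurable_fun_sum _ fun i _ => ?_
  refine StronglyMeasurable.smul_const ?_ _
  refine Measurable.stronglyMeasurable ?_
  refine measurable_of_tendsto_metrizable (f := fun (n : ℕ) ω =>
    (n : ℝ) • (realise τ f ω (0 + (n:ℝ)⁻¹ • EuclideanSpace.single i 1) - realise τ f ω 0)) ?_ ?_
  · intro n
    unfold realise
    exact ((hf.comp (hx _)).sub (hf.comp (hx _))).const_smul (n : ℝ)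
  · rw [tendsto_pi_nhds]
    intro ω
    have := (((hs ω).differentiable (by simp)) 0).hasFDerivAt.lim_real (EuclideanSpace.single i 1)
    exact this.comp tendsto_natCast_atTop_atTop

/-- Mollification of a random function. -/
noncomputable def moll {d : ℕ} {Ω : Type*} (τ : Rd d → Ω → Ω) (V : Ω → ℝ) (ρ : Rd d → ℝ) (ω : Ω) : ℝ :=
  ∫ t, ρ t * V (τ (-t) ω)

section
variable {d : ℕ} {Ω : Type*} [MeasurableSpace Ω] {P : Measure Ω} {τ : Rd d → Ω → Ω}

theorem moll_realise (hadd : ∀ x y ω, τ (x + y) ω = τ x (τ y ω)) (V : Ω → ℝ) (ρ : Rd d → ℝ) (ω : Ω) :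
    realise τ (moll τ V ρ) ω =
      (ρ ⋆[ContinuousLinearMap.lsmul ℝ ℝ, volume] (realise τ V ω)) := by
  funext z
  simp only [realise, moll, convolution_def, ContinuousLinearMap.lsmul_apply, smul_eq_mul]
  congr 1
  funext t
  rw [← hadd, neg_add_eq_sub]

theorem moll_realise' (hadd : ∀ x y ω, τ (x + y) ω = τ x (τ y ω)) (V : Ω → ℝ) (ρ : Rd d → ℝ) (ω : Ω) :
    realise τ (moll τ V ρ) ω =
      ((realise τ V ω) ⋆[ContinuousLinearMap.lsmul ℝ ℝ, volume] ρ) := by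
  rw [moll_realise hadd]
  funext z
  rw [convolution_lsmul_swap, convolution_def]
  simp [mul_comm]

theorem moll_meas (hτ : Measurable (Function.uncurry τ)) {V : Ω → ℝ} (hV : Measurable V)
    {ρ : Rd d → ℝ} (hρ : Measurable ρ) : Measurable (moll τ V ρ) := by
  have : StronglyMeasurable (fun p : Ω × Rd d => ρ p.2 * V (τ (-p.2) p.1)) := by
    refine Measurable.stronglyMeasurable ?_
    refine (hρ.comp measurable_snd).mul (hV.comp ?_)
    exact hτ.comp (measurable_snd.neg.prodMk measurable_fst)
  exact this.integral_prod_right.measurable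

theorem moll_bound {V : Ω → ℝ} {M : ℝ} (hM : ∀ ω, ‖V ω‖ ≤ M) {ρ : Rd d → ℝ} (hρ0 : ∀ x, 0 ≤ ρ x)
    (hρi : Integrable ρ volume) (hρ1 : ∫ x, ρ x = 1) (ω : Ω) : ‖moll τ V ρ ω‖ ≤ M := by
  calc _ ≤ ∫ t, ρ t * M := by
        refine norm_integral_le_of_norm_le (hρi.mul_const M) ?_
        refine Eventually.of_forall fun t => ?_
        rw [norm_mul, Real.norm_of_nonneg (hρ0 t)]
        exact mul_le_mul_of_nonneg_left (hM _) (hρ0 t)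
    _ = M := by rw [integral_mul_const, hρ1, one_mul]

theorem moll_integral [IsProbabilityMeasure P] (hτ : Measurable (Function.uncurry τ))
    (hmp : ∀ x, MeasurePreserving (τ x) P P) {V : Ω → ℝ} (hV : Measurable V)
    {M : ℝ} (hM : ∀ ω, ‖V ω‖ ≤ M) {ρ : Rd d → ℝ} (hρm : Measurable ρ)
    (hρi : Integrable ρ volume) (hρ1 : ∫ x, ρ x = 1) :
    ∫ ω, moll τ V ρ ω ∂P = ∫ ω, V ω ∂P := by
  unfold moll
  rw [integral_integral_swap]
  · have : ∀ t, ∫ ω, ρ t * V (τ (-t) ω) ∂P = ρ t * ∫ ω, V ω ∂P := fun t => by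
      rw [integral_const_mul]
      congr 1
      rw [← integral_map (hmp (-t)).measurable.aemeasurable (by rw [(hmp (-t)).map_eq]; exact hV.aestronglyMeasurable), (hmp (-t)).map_eq]
    simp_rw [this]
    rw [integral_mul_const, hρ1, one_mul]
  · have h1 : Integrable (fun p : Ω × Rd d => M * ρ p.2) (P.prod volume) :=
      (hρi.comp_snd P).const_mul M
    refine h1.mono ?_ ?_
    · refine Measurable.aestronglyMeasurable ?_
      refine (hρm.comp measurable_snd).mul (hV.comp ?_)
      exact hτ.comp (measurable_snd.neg.prodMk measurable_fst)
    · refine Eventually.of_forall fun p => ?_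
      simp only [Function.uncurry, norm_mul]
      rw [mul_comm]
      exact mul_le_mul_of_nonneg_right ((hM _).trans (le_abs_self M)) (norm_nonneg _)

theorem moll_tendsto [IsProbabilityMeasure P] (hτ : Measurable (Function.uncurry τ))
    (hadd : ∀ x y ω, τ (x + y) ω = τ x (τ y ω))
    (hmp : ∀ x, MeasurePreserving (τ x) P P) {V : Ω → ℝ} (hV : Measurable V)
    {M : ℝ} (hM : ∀ ω, ‖V ω‖ ≤ M) (φ : ℕ → ContDiffBump (0 : Rd d)) {K : ℝ}
    (hφ : Tendsto (fun i ↦ (φ i).rOut) atTop (𝓝 0))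
    (h'φ : ∀ i, (φ i).rOut ≤ K * (φ i).rIn) :
    ∀ᵐ ω ∂P, Tendsto (fun n => moll τ V ((φ n).normed volume) ω) atTop (𝓝 (V ω)) := by
  have hm : ∀ n, Measurable (moll τ V ((φ n).normed volume)) := fun n =>
    moll_meas hτ hV (φ n).continuous_normed.measurable
  set S := {ω | Tendsto (fun n => moll τ V ((φ n).normed volume) ω) atTop (𝓝 (V ω))} with hS
  have hSm : MeasurableSet S := measurableSet_tendsto_fun hm hV
  have h1 : ∀ ω, ∀ᵐ z : Rd d, τ z ω ∈ S := by
    intro ω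
    have hli : LocallyIntegrable (realise τ V ω) volume := by
      refine (locallyIntegrable_const M).mono ?_ ?_
      · exact (hV.comp (hτ.comp measurable_prodMk_right)).aestronglyMeasurable
      · exact Eventually.of_forall fun t => (hM _).trans (le_abs_self M)
    filter_upwards [ContDiffBump.ae_convolution_tendsto_right_of_locallyIntegrable hφ
      (Eventually.of_forall h'φ) hli] with z hz
    simp_rw [← moll_realise hadd] at hz
    exact hz
  have h2 : ∀ᵐ z : Rd d, ∀ᵐ ω ∂P, τ z ω ∈ S := by
    rw [Measure.ae_ae_comm]
    · exact Eventually.of_forall h1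
    · exact hτ hSm
  obtain ⟨z, hz⟩ := h2.exists
  have := (hmp z).map_eq
  change ∀ᵐ ω ∂P, ω ∈ S
  rw [← this]
  exact (ae_map_iff (hmp z).measurable.aemeasurable hSm).2 hz
end

section
variable {d : ℕ} {Ω : Type*} [MeasurableSpace Ω] {P : Measure Ω} {τ : Rd d → Ω → Ω}

theorem memF_upper (h0 : ∀ ω, τ 0 ω = ω) {f : Ω → ℝ} (hf : memF P τ f) : ∃ C, ∀ ω, f ω ≤ C := by
  obtain ⟨C, hC⟩ := hf.2.2.2.2.2 0
  refine ⟨C, fun ω => ?_⟩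
  have := hC ω
  rw [norm_iteratedFDeriv_zero] at this
  simp only [realise, h0] at this
  exact (le_abs_self _).trans this

theorem memF_grad_int (hX : IsMDS P τ) {f : Ω → ℝ} (hf : memF P τ f) :
    Integrable (fun ω => ‖fderiv ℝ (realise τ f ω) 0‖ ^ 2 / (8 * f ω)) P := by
  obtain ⟨hP, hτ, hadd, h0, hmp⟩ := hX
  obtain ⟨hm, hi, h1, ⟨c, hc, hcf⟩, hs, hb⟩ := hf
  obtain ⟨C, hC⟩ := hb 1
  have hsm := fderiv_sm hτ h0 hm hs
  refine Integrable.of_bound (C := C ^ 2 / (8 * c)) ?_ ?_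
  · exact ((hsm.norm.measurable.pow_const 2).div (hm.const_mul 8)).aestronglyMeasurable
  · refine Eventually.of_forall fun ω => ?_
    have h2 := hC ω
    rw [norm_iteratedFDeriv_one] at h2
    have h3 := hcf ω
    have h4 : 0 < f ω := hc.trans_le h3
    rw [Real.norm_of_nonneg (by positivity)]
    gcongr

theorem transport_lower (hX : IsMDS P τ) {f : Ω → ℝ} (hf : memF P τ f) {y : Rd d} (hy : y ≠ 0) :
    ‖y‖ ^ 2 / 2 ≤ transport P τ f y := by
  obtain ⟨hP, hτ, hadd, h0, hmp⟩ := hX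
  obtain ⟨hm, hi, h1, ⟨c, hc, hcf⟩, hs, hb⟩ := hf
  refine le_csInf ?_ ?_
  · refine ⟨_, fun _ => y, ⟨measurable_const, integrable_const y, by simp, fun ω => ?_, fun n => ?_, fun ω x => ?_⟩, rfl⟩
    · exact contDiff_const
    · exact ⟨‖iteratedFDeriv ℝ n (fun _ : Rd d => y) 0‖, fun ω => le_rfl⟩
    · simp [realise]
  · rintro r ⟨φ, ⟨pm, pi, p1, ps, pb, -⟩, rfl⟩
    obtain ⟨C, hC⟩ := pb 0
    have hCφ : ∀ ω, ‖φ ω‖ ≤ C := fun ω => by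
      have := hC ω
      rw [norm_iteratedFDeriv_zero] at this
      simpa only [realise, h0] using this
    have hTi : Integrable (fun ω => ‖φ ω‖ ^ 2 / (2 * f ω)) P := by
      refine Integrable.of_bound (C := C ^ 2 / (2 * c)) ?_ ?_
      · exact ((pm.norm.pow_const 2).div (hm.const_mul 2)).aestronglyMeasurable
      · refine Eventually.of_forall fun ω => ?_
        have h2 := hCφ ω
        have h3 := hcf ω
        have h4 : 0 < f ω := hc.trans_le h3
        rw [Real.norm_of_nonneg (by positivity)]
        gcongr
    have hy0 : 0 < ‖y‖ := norm_pos_iff.2 hy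
    set T := ∫ ω, ‖φ ω‖ ^ 2 / (2 * f ω) ∂P with hT
    have key : ‖y‖ ≤ T / ‖y‖ + ‖y‖ / 2 := by
      calc ‖y‖ ≤ ∫ ω, ‖φ ω‖ ∂P := by rw [← p1]; exact norm_integral_le_integral_norm _
        _ ≤ ∫ ω, ((‖φ ω‖ ^ 2 / (2 * f ω)) / ‖y‖ + f ω * (‖y‖ / 2)) ∂P := by
          refine integral_mono pi.norm ((hTi.div_const _).add (hi.mul_const _)) fun ω => ?_
          have h4 : 0 < f ω := hc.trans_le (hcf ω)
          have : (‖φ ω‖ ^ 2 / (2 * f ω)) / ‖y‖ + f ω * (‖y‖ / 2) - ‖φ ω‖ =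
            (‖φ ω‖ - f ω * ‖y‖) ^ 2 / (2 * f ω * ‖y‖) := by
            field_simp
            ring
          have h5 : 0 ≤ (‖φ ω‖ - f ω * ‖y‖) ^ 2 / (2 * f ω * ‖y‖) := by positivity
          simp only
          linarith
        _ = _ := by
          rw [integral_add (hTi.div_const _) (hi.mul_const _), integral_div, integral_mul_const, h1, one_mul]
    have h6 : ‖y‖ / 2 ≤ T / ‖y‖ := by linarith
    rw [le_div_iff₀ hy0] at h6
    nlinarith

theorem transport_upper (f : Ω → ℝ) [IsProbabilityMeasure P] (hf : ∀ ω, 0 ≤ f ω) (y : Rd d) :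
    transport P τ f y ≤ ∫ ω, ‖y‖ ^ 2 / (2 * f ω) ∂P := by
  refine csInf_le ⟨0, ?_⟩ ?_
  · rintro r ⟨φ, -, rfl⟩
    refine integral_nonneg fun ω => ?_
    have := hf ω
    simp only [Pi.zero_apply]
    positivity
  · refine ⟨fun _ => y, ⟨measurable_const, integrable_const y, by simp, fun ω => ?_, fun n => ?_, fun ω x => ?_⟩, rfl⟩
    · exact contDiff_const
    · exact ⟨‖iteratedFDeriv ℝ n (fun _ : Rd d => y) 0‖, fun ω => le_rfl⟩
    · simp [realise]

theorem memF_one [IsProbabilityMeasure P] : memF P τ (fun _ => 1) := by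
  refine ⟨measurable_const, integrable_const 1, by simp, ⟨1, one_pos, fun _ => le_rfl⟩, fun ω => contDiff_const, fun n => ?_⟩
  exact ⟨‖iteratedFDeriv ℝ n (fun _ : Rd d => (1:ℝ)) 0‖, fun ω => le_rfl⟩

theorem gamma_const_lower (hX : IsMDS P τ) {a : ℝ} (ha : 0 ≤ a) {y : Rd d} (hy : y ≠ 0) :
    2 * Real.sqrt (a * (‖y‖ ^ 2 / 2)) ≤ Gamma P τ (fun _ => a) y := by
  haveI := hX.1
  unfold Gamma
  refine mul_le_mul_of_nonneg_left ?_ zero_le_two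
  refine le_csInf ⟨_, _, memF_one, rfl⟩ ?_
  rintro r ⟨f, hf, rfl⟩
  refine Real.sqrt_le_sqrt ?_
  have hE : a ≤ energy P τ (fun _ => a) f := by
    unfold energy
    rw [integral_add (memF_grad_int hX hf) (hf.2.1.const_mul a), integral_const_mul, hf.2.2.1, mul_one]
    have : 0 ≤ ∫ ω, ‖fderiv ℝ (realise τ f ω) 0‖ ^ 2 / (8 * f ω) ∂P := by
      refine integral_nonneg fun ω => ?_
      obtain ⟨c, hc, hcf⟩ := hf.2.2.2.1
      have : 0 < f ω := hc.trans_le (hcf ω)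
      simp only [Pi.zero_apply]
      positivity
    linarith
  exact mul_le_mul hE (transport_lower hX hf hy) (by positivity) (ha.trans hE)

/-- Smooth observables with bounded derivatives. -/
def SB (τ : Rd d → Ω → Ω) (h : Ω → ℝ) : Prop :=
  Measurable h ∧ (∀ ω, ContDiff ℝ (⊤ : ℕ∞) (realise τ h ω)) ∧
    (∀ n : ℕ, ∃ C, ∀ ω, ‖iteratedFDeriv ℝ n (realise τ h ω) 0‖ ≤ C)

theorem SB.affine {h : Ω → ℝ} (hh : SB τ h) (a b : ℝ) : SB τ (fun ω => a + b * h ω) := by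
  obtain ⟨hm, hs, hb⟩ := hh
  have e : ∀ ω, realise τ (fun ω => a + b * h ω) ω =
      (fun _ : Rd d => a) + b • realise τ h ω := fun ω => rfl
  have hs' : ∀ ω, ContDiff ℝ (⊤ : ℕ∞) (b • realise τ h ω) := fun ω => (hs ω).const_smul b
  refine ⟨(hm.const_mul b).const_add a, fun ω => ?_, fun n => ?_⟩
  · rw [e]
    exact contDiff_const.add (hs' ω)
  · obtain ⟨C, hC⟩ := hb n
    refine ⟨‖iteratedFDeriv ℝ n (fun _ : Rd d => a) 0‖ + |b| * C, fun ω => ?_⟩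
    have hn : ((n : ℕ∞) : WithTop ℕ∞) ≤ ((⊤ : ℕ∞) : WithTop ℕ∞) := by exact_mod_cast le_top
    rw [e, iteratedFDeriv_add_apply contDiff_const.contDiffAt ((hs' ω).of_le hn).contDiffAt,
      iteratedFDeriv_const_smul_apply ((hs ω).of_le hn).contDiffAt]
    refine (norm_add_le _ _).trans ?_
    rw [norm_smul, Real.norm_eq_abs]
    gcongr
    exact hC ω

theorem SB_moll (hX : IsMDS P τ) {V : Ω → ℝ} (hV : Measurable V)
    {M : ℝ} (hM : ∀ ω, ‖V ω‖ ≤ M) {ρ : Rd d → ℝ} (hc : HasCompactSupport ρ)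
    (hs : ContDiff ℝ (⊤ : ℕ∞) ρ) : SB τ (moll τ V ρ) := by
  obtain ⟨hP, hτ, hadd, h0, hmp⟩ := hX
  have hr : ∀ ω, Measurable (realise τ V ω) := fun ω => hV.comp (hτ.comp measurable_prodMk_right)
  refine ⟨moll_meas hτ hV hs.continuous.measurable, fun ω => ?_, fun n => ?_⟩
  · rw [moll_realise' hadd]
    refine hc.contDiff_convolution_right _ ?_ hs
    refine (locallyIntegrable_const M).mono (hr ω).aestronglyMeasurable ?_
    exact Eventually.of_forall fun t => (hM _).trans (le_abs_self M)
  · obtain ⟨C, hC⟩ := conv_bound M n ρ hc hs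
    refine ⟨C, fun ω => ?_⟩
    rw [moll_realise' hadd]
    exact hC _ (hr ω) (fun x => hM _) 0

theorem exists_h (hX : IsMDS P τ) {V : Ω → ℝ} (hV : Measurable V)
    {M : ℝ} (hM : ∀ ω, ‖V ω‖ ≤ M) (hnondet : ¬ ∃ a : ℝ, V =ᵐ[P] fun _ => a) :
    ∃ h : Ω → ℝ, SB τ h ∧ ∫ ω, h ω ∂P = 0 ∧ (∃ K, 0 ≤ K ∧ ∀ ω, |h ω| ≤ K) ∧ ∫ ω, V ω * h ω ∂P < 0 := by
  have hX' := hX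
  obtain ⟨hP, hτ, hadd, h0, hmp⟩ := hX
  set a := ∫ ω, V ω ∂P with ha
  let φ : ℕ → ContDiffBump (0 : Rd d) := fun n =>
    ⟨1 / ((n : ℝ) + 1), 2 * (1 / ((n : ℝ) + 1)), by positivity, by
      have : 0 < 1 / ((n : ℝ) + 1) := by positivity
      linarith⟩
  let h : ℕ → Ω → ℝ := fun n ω => a + (-1) * moll τ V ((φ n).normed volume) ω
  have hVi : Integrable V P := Integrable.of_bound hV.aestronglyMeasurable (C := M) (Eventually.of_forall hM)
  have hM0 : 0 ≤ M := by
    obtain ⟨ω⟩ := nonempty_of_isProbabilityMeasure P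
    exact (norm_nonneg _).trans (hM ω)
  have hmb : ∀ n ω, ‖moll τ V ((φ n).normed volume) ω‖ ≤ M := fun n =>
    moll_bound hM (φ n).nonneg_normed (φ n).integrable_normed (φ n).integral_normed
  have hmm : ∀ n, Measurable (moll τ V ((φ n).normed volume)) := fun n =>
    moll_meas hτ hV (φ n).continuous_normed.measurable
  have hhb : ∀ n ω, |h n ω| ≤ |a| + M := fun n ω => by
    refine (abs_add_le _ _).trans ?_
    rw [abs_mul]
    have := hmb n ω
    rw [Real.norm_eq_abs] at this
    simpa using this
  have hhm : ∀ n, Measurable (h n) := fun n => ((hmm n).const_mul _).const_add _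
  have hlim : Tendsto (fun n => ∫ ω, V ω * h n ω ∂P) atTop (𝓝 (∫ ω, V ω * (a + (-1) * V ω) ∂P)) := by
    refine tendsto_integral_of_dominated_convergence (fun _ => M * (|a| + M)) ?_ (integrable_const _) ?_ ?_
    · exact fun n => (hV.mul (hhm n)).aestronglyMeasurable
    · intro n
      refine Eventually.of_forall fun ω => ?_
      rw [norm_mul]
      exact mul_le_mul (hM ω) (hhb n ω) (norm_nonneg _) hM0
    · have hφ : Tendsto (fun i ↦ (φ i).rOut) atTop (𝓝 0) := by
        have := (tendsto_one_div_add_atTop_nhds_zero_nat (𝕜 := ℝ)).const_mul 2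
        rw [mul_zero] at this
        exact this
      filter_upwards [moll_tendsto hτ hadd hmp hV hM φ (K := 2) hφ (fun i => le_rfl)] with ω hω
      exact ((hω.const_mul (-1)).const_add a).const_mul (V ω)
  have hsqi : Integrable (fun ω => (V ω - a) ^ 2) P := by
    refine Integrable.of_bound (C := (M + |a|) ^ 2) ((hV.sub_const a).pow_const 2).aestronglyMeasurable ?_
    refine Eventually.of_forall fun ω => ?_
    rw [norm_pow]
    gcongr
    exact (norm_sub_le _ _).trans (add_le_add (hM ω) le_rfl)
  have hneg : ∫ ω, V ω * (a + (-1) * V ω) ∂P < 0 := by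
    have e : ∫ ω, V ω * (a + (-1) * V ω) ∂P = - ∫ ω, (V ω - a) ^ 2 ∂P := by
      have : (fun ω => V ω * (a + (-1) * V ω)) = fun ω => a ^ 2 - a * V ω - (V ω - a) ^ 2 := by
        funext ω
        ring
      have hi2 : Integrable (fun ω => a ^ 2 - a * V ω) P := (integrable_const _).sub (hVi.const_mul a)
      rw [this, integral_sub hi2 hsqi,
        integral_sub (integrable_const _) (hVi.const_mul a), integral_const_mul, ← ha]
      simp
      ring
    rw [e, neg_lt_zero]
    refine lt_of_le_of_ne (integral_nonneg fun ω => sq_nonneg _) fun h => hnondet ⟨a, ?_⟩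
    have := (integral_eq_zero_iff_of_nonneg (fun ω => sq_nonneg _) hsqi).1 h.symm
    filter_upwards [this] with ω hω
    have : V ω - a = 0 := by simpa using hω
    linarith
  obtain ⟨n, hn⟩ := (hlim.eventually (gt_mem_nhds hneg)).exists
  refine ⟨h n, ?_, ?_, ⟨|a| + M, by positivity, hhb n⟩, hn⟩
  · exact (SB_moll hX' hV hM (φ n).hasCompactSupport_normed (φ n).contDiff_normed).affine a (-1)
  · have hmi : Integrable (moll τ V ((φ n).normed volume)) P :=
      Integrable.of_bound (hmm n).aestronglyMeasurable (C := M) (Eventually.of_forall (hmb n))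
    simp only [h]
    rw [integral_add (integrable_const _) (hmi.const_mul _), integral_const_mul,
      moll_integral hτ hmp hV hM (φ n).continuous_normed.measurable (φ n).integrable_normed (φ n).integral_normed]
    simp [ha]
end


/-- strict inequality `Γ_V(y) < Γ_{𝔼V}(y)` for a nondeterministic, weakly
differentiable potential with bounded gradient and `0 < v_min ≤ V ≤ v_max < ∞`. -/
theorem gamma_strict_lt {d : ℕ} {Ω : Type*} [MeasurableSpace Ω]
    (P : Measure Ω) (τ : Rd d → Ω → Ω) (hX : IsMDS P τ)
    (V : Ω → ℝ) (hV : IsPotential P V)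
    (hnondet : ¬ ∃ a : ℝ, V =ᵐ[P] fun _ => a)
    (vmin vmax : ℝ) (hvmin : 0 < vmin)
    (hbounds : ∀ ω, vmin ≤ V ω ∧ V ω ≤ vmax)
    (G : Ω → Rd d) (hGmeas : Measurable G) (hGbdd : ∃ C, ∀ ω, ‖G ω‖ ≤ C)
    (hweak : ∀ i : Fin d, ∀ᵐ ω ∂P, ∀ ψ : Rd d → ℝ,
      ContDiff ℝ (⊤ : ℕ∞) ψ → HasCompactSupport ψ →
        (∫ x, V (τ x ω) * fderiv ℝ ψ x (EuclideanSpace.single i 1)) =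
          -∫ x, G (τ x ω) i * ψ x)
    (y : Rd d) (hy : y ≠ 0) :
    Gamma P τ V y < Gamma P τ (fun _ => ∫ ω, V ω ∂P) y := by
  have hX' := hX
  obtain ⟨hP, hτ, hadd, h0, hmp⟩ := hX
  have hM : ∀ ω, ‖V ω‖ ≤ vmax := fun ω => by
    rw [Real.norm_of_nonneg (hV.2.1 ω)]
    exact (hbounds ω).2
  obtain ⟨h, hSB, hh0, ⟨K, hK0, hK⟩, hneg⟩ := exists_h hX' hV.1 hM hnondet
  have hVi := hV.2.2
  set a := ∫ ω, V ω ∂P with ha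
  have ha0 : 0 ≤ a := integral_nonneg hV.2.1
  refine lt_of_lt_of_le ?_ (gamma_const_lower hX' ha0 hy)
  set κ := ∫ ω, V ω * h ω ∂P with hκ
  obtain ⟨K1, hK1⟩ := hSB.2.2 1
  have hhi : Integrable h P := Integrable.of_bound hSB.1.aestronglyMeasurable (C := K) (Eventually.of_forall hK)
  have hVhi : Integrable (fun ω => V ω * h ω) P := by
    refine Integrable.of_bound (C := vmax * K) (hV.1.mul hSB.1).aestronglyMeasurable ?_
    refine Eventually.of_forall fun ω => ?_
    rw [norm_mul]
    exact mul_le_mul (hM ω) (hK ω) (norm_nonneg _) ((norm_nonneg _).trans (hM ω))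
  -- choice of `ε`
  obtain ⟨ε, hε0, hεK, hε⟩ : ∃ ε : ℝ, 0 < ε ∧ ε * K < 1 / 2 ∧
      (κ + ε * (K1 ^ 2 / 4)) * (1 + ε ^ 2 * (2 * K ^ 2)) + a * (ε * (2 * K ^ 2)) < 0 := by
    have c1 : Tendsto (fun ε : ℝ => ε * K) (𝓝[>] 0) (𝓝 (0 * K)) :=
      (Continuous.tendsto (by fun_prop) 0).mono_left nhdsWithin_le_nhds
    have c2 : Tendsto (fun ε : ℝ => (κ + ε * (K1 ^ 2 / 4)) * (1 + ε ^ 2 * (2 * K ^ 2)) + a * (ε * (2 * K ^ 2)))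
        (𝓝[>] 0) (𝓝 ((κ + 0 * (K1 ^ 2 / 4)) * (1 + 0 ^ 2 * (2 * K ^ 2)) + a * (0 * (2 * K ^ 2)))) :=
      (Continuous.tendsto (f := fun ε : ℝ => (κ + ε * (K1 ^ 2 / 4)) * (1 + ε ^ 2 * (2 * K ^ 2)) + a * (ε * (2 * K ^ 2)))
        (by fun_prop) 0).mono_left nhdsWithin_le_nhds
    have e1 := c1.eventually (gt_mem_nhds (show 0 * K < 1 / 2 by norm_num))
    have e2 := c2.eventually (gt_mem_nhds (show _ < (0:ℝ) by simpa using hneg))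
    have e3 : ∀ᶠ ε : ℝ in 𝓝[>] 0, 0 < ε := eventually_mem_nhdsWithin
    obtain ⟨ε, x1, x2, x3⟩ := (e3.and (e1.and e2)).exists
    exact ⟨ε, x1, x2, x3⟩
  set f : Ω → ℝ := fun ω => 1 + ε * h ω with hf
  have hεh : ∀ ω, |ε * h ω| ≤ ε * K := fun ω => by
    rw [abs_mul, abs_of_pos hε0]
    exact mul_le_mul_of_nonneg_left (hK ω) hε0.le
  have hf2 : ∀ ω, 1 / 2 ≤ f ω := fun ω => by
    have := (abs_le.1 (hεh ω)).1
    simp only [hf]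
    linarith
  have hfSB : SB τ f := hSB.affine 1 ε
  have hfi : Integrable f P := (integrable_const _).add (hhi.const_mul ε)
  have hfF : memF P τ f := by
    refine ⟨hfSB.1, hfi, ?_, ⟨1 / 2, by norm_num, hf2⟩, hfSB.2.1, hfSB.2.2⟩
    simp only [hf]
    rw [integral_add (integrable_const _) (hhi.const_mul ε), integral_const_mul, hh0]
    simp
  have hE0 : 0 ≤ energy P τ V f := by
    refine integral_nonneg fun ω => ?_
    have h1 : 0 ≤ f ω := le_trans (by norm_num) (hf2 ω)
    have h2 := hV.2.1 ω
    simp only [Pi.zero_apply]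
    positivity
  have hEu : energy P τ V f ≤ a + ε * κ + ε ^ 2 * (K1 ^ 2 / 4) := by
    have e : ∫ ω, (ε ^ 2 * (K1 ^ 2 / 4) + (V ω + ε * (V ω * h ω))) ∂P = a + ε * κ + ε ^ 2 * (K1 ^ 2 / 4) := by
      have hi2 : Integrable (fun ω => V ω + ε * (V ω * h ω)) P := hVi.add (hVhi.const_mul ε)
      rw [integral_add (integrable_const _) hi2,
        integral_add hVi (hVhi.const_mul ε), integral_const_mul ε, ← ha, ← hκ,
        integral_const, probReal_univ, one_smul]
      ring
    rw [← e]
    have hVf : Integrable (fun ω => V ω * f ω) P := by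
      have : (fun ω => V ω * f ω) = fun ω => V ω + ε * (V ω * h ω) := by
        funext ω
        simp only [hf]
        ring
      rw [this]
      exact hVi.add (hVhi.const_mul ε)
    refine integral_mono ((memF_grad_int hX' hfF).add hVf)
      ((integrable_const _).add (hVi.add (hVhi.const_mul ε))) fun ω => ?_
    have g1 : fderiv ℝ (realise τ f ω) 0 = ε • fderiv ℝ (realise τ h ω) 0 := by
      have : realise τ f ω = fun z => 1 + ε • realise τ h ω z := rfl
      rw [this, fderiv_const_add]
      exact fderiv_const_smul (((hSB.2.1 ω).differentiable (by simp)) 0) ε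
    have g2 := hK1 ω
    rw [norm_iteratedFDeriv_one] at g2
    have g3 : ‖fderiv ℝ (realise τ f ω) 0‖ ^ 2 / (8 * f ω) ≤ ε ^ 2 * (K1 ^ 2 / 4) := by
      rw [g1, norm_smul, Real.norm_of_nonneg hε0.le, mul_pow]
      have h1 := hf2 ω
      calc _ ≤ ε ^ 2 * K1 ^ 2 / (8 * (1 / 2)) := by gcongr
        _ = _ := by ring
    have g4 : V ω * f ω = V ω + ε * (V ω * h ω) := by
      simp only [hf]
      ring
    simp only
    rw [g4]
    linarith
  have hTu : transport P τ f y ≤ ‖y‖ ^ 2 / 2 * (1 + ε ^ 2 * (2 * K ^ 2)) := by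
    refine (transport_upper f (fun ω => le_trans (by norm_num) (hf2 ω)) y).trans ?_
    have e : ∫ ω, (‖y‖ ^ 2 / 2 * ((1 + ε ^ 2 * (2 * K ^ 2)) - ε * h ω)) ∂P =
        ‖y‖ ^ 2 / 2 * (1 + ε ^ 2 * (2 * K ^ 2)) := by
      rw [integral_const_mul, integral_sub (integrable_const _) (hhi.const_mul ε),
        integral_const_mul, hh0]
      simp
    rw [← e]
    refine integral_mono_of_nonneg ?_ (((integrable_const _).sub (hhi.const_mul ε)).const_mul _) ?_
    · refine Eventually.of_forall fun ω => ?_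
      have h1 : 0 ≤ f ω := le_trans (by norm_num) (hf2 ω)
      simp only [Pi.zero_apply]
      positivity
    · refine Eventually.of_forall fun ω => ?_
      have h1 : 0 < f ω := lt_of_lt_of_le (by norm_num) (hf2 ω)
      have h2 : ‖y‖ ^ 2 / (2 * f ω) = ‖y‖ ^ 2 / 2 * (1 / f ω) := by
        field_simp
      simp only
      rw [h2]
      refine mul_le_mul_of_nonneg_left ?_ (by positivity)
      rw [div_le_iff₀ h1]
      have h3 := hεh ω
      have h4 : (ε * h ω) ^ 2 ≤ ε ^ 2 * K ^ 2 := by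
        rw [← mul_pow, ← sq_abs]
        gcongr
      have h5 := hf2 ω
      have h6 : f ω = 1 + ε * h ω := rfl
      nlinarith [mul_le_mul_of_nonneg_right h4 h1.le, sq_nonneg (ε * h ω), mul_nonneg (sq_nonneg (ε * h ω)) (sub_nonneg.2 h5)]
  have hT0 : 0 ≤ transport P τ f y := le_trans (by positivity) (transport_lower hX' hfF hy)
  have hy0 : 0 < ‖y‖ := norm_pos_iff.2 hy
  unfold Gamma
  refine mul_lt_mul_of_pos_left ?_ two_pos
  refine lt_of_le_of_lt (csInf_le ⟨0, ?_⟩ ⟨f, hfF, rfl⟩) ?_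
  · rintro r ⟨g, -, rfl⟩
    exact Real.sqrt_nonneg _
  · refine Real.sqrt_lt_sqrt (mul_nonneg hE0 hT0) ?_
    calc energy P τ V f * transport P τ f y
        ≤ (a + ε * κ + ε ^ 2 * (K1 ^ 2 / 4)) * (‖y‖ ^ 2 / 2 * (1 + ε ^ 2 * (2 * K ^ 2))) :=
          mul_le_mul hEu hTu hT0 (hE0.trans hEu)
      _ = (a + ε * ((κ + ε * (K1 ^ 2 / 4)) * (1 + ε ^ 2 * (2 * K ^ 2)) + a * (ε * (2 * K ^ 2)))) * (‖y‖ ^ 2 / 2) := by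
          ring
      _ < a * (‖y‖ ^ 2 / 2) := by
          refine mul_lt_mul_of_pos_right ?_ (by positivity)
          have := mul_neg_of_pos_of_neg hε0 hε
          linarith
end

section
/- Let X = (Ω, ℱ, ℙ, τ) be a metric dynamical system, c ≥ 0, V a potential and V_n := V/n for n ∈ ℕ. Then for every y ∈ ℝ^d and every n ∈ ℕ: Γ_V(y)² ≤ n·(Γ_{c+V_n}(y)² − Γ_c(y)²) ≤ 2𝔼[V]·|y|². -/
open MeasureTheory Filter

section helpers

variable {d : ℕ} {Ω : Type*} [MeasurableSpace Ω]

lemma memF_one_s16 {P : Measure Ω} {τ : Rd d → Ω → Ω} (hX : IsMDS P τ) :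
    memF P τ (fun _ => (1 : ℝ)) := by
  have := hX.1
  refine ⟨measurable_const, integrable_const _, by simp, ⟨1, one_pos, fun _ => le_rfl⟩,
    fun ω => ?_, fun n => ⟨‖iteratedFDeriv ℝ n (fun _ : Rd d => (1 : ℝ)) 0‖, fun ω => le_rfl⟩⟩
  unfold realise
  exact contDiff_const

lemma memPhi_const {P : Measure Ω} {τ : Rd d → Ω → Ω} (hX : IsMDS P τ) (y : Rd d) :
    memPhi P τ y (fun _ => y) := by
  have := hX.1
  refine ⟨measurable_const, integrable_const _, by simp,
    fun ω => ?_, fun n => ⟨‖iteratedFDeriv ℝ n (fun _ : Rd d => y) 0‖, fun ω => le_rfl⟩, ?_⟩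
  · unfold realise
    exact contDiff_const
  · intro ω x
    simp [realise]

lemma bdd_of_memF {P : Measure Ω} {τ : Rd d → Ω → Ω} (hX : IsMDS P τ) {E : Type*}
    [NormedAddCommGroup E] [NormedSpace ℝ E] {f : Ω → E}
    (h : ∀ n : ℕ, ∃ C, ∀ ω, ‖iteratedFDeriv ℝ n (realise τ f ω) 0‖ ≤ C) :
    ∃ C, ∀ ω, ‖f ω‖ ≤ C := by
  obtain ⟨C, hC⟩ := h 0
  refine ⟨C, fun ω => ?_⟩
  have := hC ω
  rw [norm_iteratedFDeriv_zero] at this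
  simpa [realise, hX.2.2.2.1 ω] using this

lemma measurable_norm_fderiv {P : Measure Ω} {τ : Rd d → Ω → Ω} (hX : IsMDS P τ) {f : Ω → ℝ}
    (hf : memF P τ f) : Measurable fun ω => ‖fderiv ℝ (realise τ f ω) 0‖ := by
  have hd : ∀ ω, DifferentiableAt ℝ (realise τ f ω) 0 := fun ω =>
    (hf.2.2.2.2.1 ω).differentiable (by simp) 0
  have hτ : ∀ x, Measurable (τ x) := fun x => (hX.2.2.2.2 x).measurable
  have key : ∀ v : Rd d, Measurable fun ω => fderiv ℝ (realise τ f ω) 0 v := by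
    intro v
    refine measurable_of_tendsto_metrizable (f := fun (n : ℕ) ω =>
      (n : ℝ) • (realise τ f ω (0 + (n : ℝ)⁻¹ • v) - realise τ f ω 0)) ?_ ?_
    · intro n
      unfold realise
      exact ((hf.1.comp (hτ _)).sub (hf.1.comp (hτ _))).const_smul (n : ℝ)
    · rw [tendsto_pi_nhds]
      intro ω
      have h := (hd ω).hasFDerivAt.lim v (c := fun n : ℕ => (n : ℝ)) (l := atTop)
        (tendsto_norm_atTop_atTop.comp tendsto_natCast_atTop_atTop)
      exact h
  have e : ∀ ω, fderiv ℝ (realise τ f ω) 0 = ∑ i : Fin d,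
      (fderiv ℝ (realise τ f ω) 0 (EuclideanSpace.single i 1)) •
        (EuclideanSpace.proj i : Rd d →L[ℝ] ℝ) := by
    intro ω
    refine ContinuousLinearMap.ext fun v => ?_
    conv_lhs => rw [← (EuclideanSpace.basisFun (Fin d) ℝ).sum_repr v]
    simp [map_sum, mul_comm]
  have : Measurable fun ω => ‖∑ i : Fin d,
      (fderiv ℝ (realise τ f ω) 0 (EuclideanSpace.single i 1)) •
        (EuclideanSpace.proj i : Rd d →L[ℝ] ℝ)‖ := by
    have hc : Continuous fun a : Fin d → ℝ =>
      ‖∑ i : Fin d, a i • (EuclideanSpace.proj i : Rd d →L[ℝ] ℝ)‖ := by fun_prop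
    exact hc.measurable.comp (measurable_pi_lambda _ fun i => key _)
  simpa only [← e] using this

lemma integrable_kin {P : Measure Ω} {τ : Rd d → Ω → Ω} (hX : IsMDS P τ) {f : Ω → ℝ}
    (hf : memF P τ f) :
    Integrable (fun ω => ‖fderiv ℝ (realise τ f ω) 0‖ ^ 2 / (8 * f ω)) P := by
  have := hX.1
  obtain ⟨C, hC⟩ := hf.2.2.2.2.2 1
  obtain ⟨a, ha, haf⟩ := hf.2.2.2.1
  refine Integrable.of_bound (C := C ^ 2 / (8 * a))
    (((measurable_norm_fderiv hX hf).pow_const 2).div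
      (hf.1.const_mul 8)).aestronglyMeasurable (ae_of_all _ fun ω => ?_)
  have h1 : ‖fderiv ℝ (realise τ f ω) 0‖ ≤ C := by
    have := hC ω
    rwa [norm_iteratedFDeriv_one] at this
  have h2 := haf ω
  have : 0 < f ω := ha.trans_le h2
  rw [Real.norm_of_nonneg (by positivity)]
  gcongr

lemma energy_eq {P : Measure Ω} {τ : Rd d → Ω → Ω} (hX : IsMDS P τ) {f : Ω → ℝ}
    (hf : memF P τ f) {V : Ω → ℝ} (hV : Integrable V P) (c b : ℝ) :
    energy P τ (fun ω => c + V ω / b) f =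
      (∫ ω, ‖fderiv ℝ (realise τ f ω) 0‖ ^ 2 / (8 * f ω) ∂P) + c + (∫ ω, V ω * f ω ∂P) / b := by
  obtain ⟨C, hC⟩ := bdd_of_memF hX hf.2.2.2.2.2
  have hVf : Integrable (fun ω => V ω * f ω) P :=
    hV.mul_bdd hf.1.aestronglyMeasurable (ae_of_all _ hC)
  have e : ∀ ω, (c + V ω / b) * f ω = c * f ω + (V ω * f ω) / b := fun ω => by ring
  have i1 : Integrable (fun ω => c * f ω) P := hf.2.1.const_mul c
  have i2 : Integrable (fun ω => V ω * f ω / b) P := hVf.div_const b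
  have i3 : Integrable (fun ω => c * f ω + V ω * f ω / b) P := i1.add i2
  unfold energy
  simp only [e]
  rw [integral_add (integrable_kin hX hf) i3, integral_add i1 i2, integral_const_mul,
    hf.2.2.1, integral_div]
  ring

lemma transport_ge {P : Measure Ω} {τ : Rd d → Ω → Ω} (hX : IsMDS P τ) {f : Ω → ℝ}
    (hf : memF P τ f) (y : Rd d) : ‖y‖ ^ 2 / 2 ≤ transport P τ f y := by
  have := hX.1
  refine le_csInf ⟨_, _, memPhi_const hX y, rfl⟩ ?_
  rintro _ ⟨φ, hφ, rfl⟩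
  obtain ⟨C, hC⟩ := bdd_of_memF hX hφ.2.2.2.2.1
  obtain ⟨a, ha, haf⟩ := hf.2.2.2.1
  have hpos : ∀ ω, 0 < f ω := fun ω => ha.trans_le (haf ω)
  have i0 : Integrable (fun ω => ‖φ ω‖ ^ 2 / (2 * f ω)) P := by
    refine Integrable.of_bound (C := C ^ 2 / (2 * a))
      ((hφ.1.norm.pow_const 2).div (hf.1.const_mul 2)).aestronglyMeasurable
      (ae_of_all _ fun ω => ?_)
    have h1 := hC ω
    have h2 := haf ω
    have := hpos ω
    rw [Real.norm_of_nonneg (by positivity)]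
    gcongr
  have i1 : Integrable (fun ω => ‖y‖ ^ 2 / 2 * f ω) P := hf.2.1.const_mul _
  have h1 : ∫ ω, ‖y‖ * ‖φ ω‖ ∂P ≤ ∫ ω, (‖φ ω‖ ^ 2 / (2 * f ω) + ‖y‖ ^ 2 / 2 * f ω) ∂P := by
    refine integral_mono (hφ.2.1.norm.const_mul _) (i0.add i1) fun ω => ?_
    have hp := hpos ω
    have : ‖φ ω‖ ^ 2 / (2 * f ω) + ‖y‖ ^ 2 / 2 * f ω - ‖y‖ * ‖φ ω‖
        = (‖φ ω‖ - ‖y‖ * f ω) ^ 2 / (2 * f ω) := by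
      field_simp
      ring
    have h3 : 0 ≤ (‖φ ω‖ - ‖y‖ * f ω) ^ 2 / (2 * f ω) := by positivity
    show ‖y‖ * ‖φ ω‖ ≤ ‖φ ω‖ ^ 2 / (2 * f ω) + ‖y‖ ^ 2 / 2 * f ω
    linarith
  rw [integral_add i0 i1, integral_const_mul, integral_const_mul, hf.2.2.1] at h1
  have h2 : ‖y‖ ≤ ∫ ω, ‖φ ω‖ ∂P := by
    conv_lhs => rw [← hφ.2.2.1]
    exact norm_integral_le_integral_norm _
  have h3 := mul_le_mul_of_nonneg_left h2 (norm_nonneg y)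
  nlinarith

lemma transport_one_le {P : Measure Ω} {τ : Rd d → Ω → Ω} (hX : IsMDS P τ) (y : Rd d) :
    transport P τ (fun _ => 1) y ≤ ‖y‖ ^ 2 / 2 := by
  have := hX.1
  refine csInf_le ⟨0, ?_⟩ ⟨_, memPhi_const hX y, by simp⟩
  rintro _ ⟨φ, hφ, rfl⟩
  exact integral_nonneg fun ω => by positivity

lemma Gamma_sq_le {P : Measure Ω} {τ : Rd d → Ω → Ω} (V : Ω → ℝ) (y : Rd d) {f : Ω → ℝ}
    (hf : memF P τ f) (h : 0 ≤ energy P τ V f * transport P τ f y) :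
    Gamma P τ V y ^ 2 ≤ 4 * (energy P τ V f * transport P τ f y) := by
  have h0 : 0 ≤ sInf {r | ∃ f, memF P τ f ∧
      r = Real.sqrt (energy P τ V f * transport P τ f y)} := by
    refine Real.sInf_nonneg ?_
    rintro _ ⟨f, _, rfl⟩
    exact Real.sqrt_nonneg _
  have h1 : sInf {r | ∃ f, memF P τ f ∧
      r = Real.sqrt (energy P τ V f * transport P τ f y)} ≤
      Real.sqrt (energy P τ V f * transport P τ f y) := by
    refine csInf_le ⟨0, ?_⟩ ⟨f, hf, rfl⟩
    rintro _ ⟨f, _, rfl⟩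
    exact Real.sqrt_nonneg _
  have h2 := pow_le_pow_left₀ h0 h1 2
  rw [Real.sq_sqrt h] at h2
  unfold Gamma
  rw [mul_pow]
  linarith

lemma le_Gamma_sq {P : Measure Ω} {τ : Rd d → Ω → Ω} (hX : IsMDS P τ) (V : Ω → ℝ) (y : Rd d)
    {K : ℝ} (h : ∀ f, memF P τ f → K ≤ 4 * (energy P τ V f * transport P τ f y)) :
    K ≤ Gamma P τ V y ^ 2 := by
  have h1 : Real.sqrt (K / 4) ≤ sInf {r | ∃ f, memF P τ f ∧
      r = Real.sqrt (energy P τ V f * transport P τ f y)} := by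
    refine le_csInf ⟨_, _, memF_one_s16 hX, rfl⟩ ?_
    rintro _ ⟨f, hf, rfl⟩
    exact Real.sqrt_le_sqrt (by linarith [h f hf])
  rw [Real.sqrt_le_iff] at h1
  unfold Gamma
  rw [mul_pow]
  linarith [h1.2]

end helpers

/-- the scaling estimate
`Γ_V(y)² ≤ n(Γ_{c+V/n}(y)² − Γ_c(y)²) ≤ 2𝔼[V]|y|²`. -/
theorem gamma_scaling_rate {d : ℕ} {Ω : Type*} [MeasurableSpace Ω]
    (P : Measure Ω) (τ : Rd d → Ω → Ω) (hX : IsMDS P τ)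
    (V : Ω → ℝ) (hV : IsPotential P V) (c : ℝ) (hc : 0 ≤ c)
    (n : ℕ) (hn : 0 < n) (y : Rd d) :
    (Gamma P τ V y) ^ 2 ≤
      (n : ℝ) * ((Gamma P τ (fun ω => c + V ω / n) y) ^ 2 -
        (Gamma P τ (fun _ => c) y) ^ 2) ∧
    (n : ℝ) * ((Gamma P τ (fun ω => c + V ω / n) y) ^ 2 -
        (Gamma P τ (fun _ => c) y) ^ 2) ≤ 2 * (∫ ω, V ω ∂P) * ‖y‖ ^ 2 := by
  have := hX.1
  have hn' : (0 : ℝ) < n := by exact_mod_cast hn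
  have hI : ∀ f, memF P τ f →
      0 ≤ ∫ ω, ‖fderiv ℝ (realise τ f ω) 0‖ ^ 2 / (8 * f ω) ∂P := by
    intro f hf
    obtain ⟨a, ha, haf⟩ := hf.2.2.2.1
    refine integral_nonneg fun ω => ?_
    have : 0 < f ω := ha.trans_le (haf ω)
    positivity
  have hVf : ∀ f, memF P τ f → 0 ≤ ∫ ω, V ω * f ω ∂P := by
    intro f hf
    obtain ⟨a, ha, haf⟩ := hf.2.2.2.1
    exact integral_nonneg fun ω => mul_nonneg (hV.2.1 ω) (ha.le.trans (haf ω))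
  have eV : ∀ f, memF P τ f → energy P τ V f = _ := fun f hf => by
    have := energy_eq hX hf hV.2.2 0 1
    simp only [zero_add, div_one, add_zero] at this
    exact this
  have ec : ∀ f, memF P τ f → energy P τ (fun _ => c) f = _ := fun f hf => by
    have := energy_eq hX hf (integrable_zero Ω ℝ P) c 1
    simp only [Pi.zero_apply, div_one, add_zero, zero_mul, integral_zero] at this
    exact this
  have ecV := fun f hf => energy_eq (f := f) hX hf hV.2.2 c n
  have hT := fun f hf => transport_ge (f := f) hX hf y
  have T1 : transport P τ (fun _ => 1) y = ‖y‖ ^ 2 / 2 :=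
    le_antisymm (transport_one_le hX y) (hT _ (memF_one_s16 hX))
  have I1 : ∫ ω, ‖fderiv ℝ (realise τ (fun _ => (1 : ℝ)) ω) 0‖ ^ 2 / (8 * 1) ∂P = 0 := by
    have hr : ∀ ω, realise τ (fun _ => (1 : ℝ)) ω = fun _ => 1 := fun ω => rfl
    simp only [hr]
    simp
  have hy : 0 ≤ ‖y‖ ^ 2 / 2 := by positivity
  have hEV : 0 ≤ ∫ ω, V ω ∂P := integral_nonneg hV.2.1
  have hc1 : Gamma P τ (fun _ => c) y ^ 2 ≤ 2 * c * ‖y‖ ^ 2 := by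
    have e := ec _ (memF_one_s16 hX)
    rw [I1, zero_add] at e
    have := Gamma_sq_le (fun _ => c) y (memF_one_s16 hX) (by rw [T1, e]; positivity)
    rw [T1, e] at this
    linarith
  have hc2 : 2 * c * ‖y‖ ^ 2 ≤ Gamma P τ (fun _ => c) y ^ 2 := by
    refine le_Gamma_sq hX _ y fun f hf => ?_
    rw [ec f hf]
    nlinarith [mul_nonneg (hI f hf) (hy.trans (hT f hf)),
      mul_le_mul_of_nonneg_left (hT f hf) hc]
  constructor
  · have h : Gamma P τ V y ^ 2 / n + 2 * c * ‖y‖ ^ 2 ≤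
        Gamma P τ (fun ω => c + V ω / n) y ^ 2 := by
      refine le_Gamma_sq hX _ y fun f hf => ?_
      have hT0 := hy.trans (hT f hf)
      have h1 := Gamma_sq_le V y hf (by
        rw [eV f hf]; exact mul_nonneg (add_nonneg (hI f hf) (hVf f hf)) hT0)
      rw [eV f hf] at h1
      rw [ecV f hf]
      have hn1 : (1 : ℝ) ≤ n := by exact_mod_cast hn
      have a1 := mul_nonneg (hI f hf) hT0
      have a2 := mul_le_mul_of_nonneg_left (hT f hf) hc
      have a3 := div_le_div_of_nonneg_right h1 hn'.le
      have a4 := div_le_self a1 hn1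
      refine (add_le_add_left a3 _).trans ?_
      set I := ∫ ω, ‖fderiv ℝ (realise τ f ω) 0‖ ^ 2 / (8 * f ω) ∂P
      set A := ∫ ω, V ω * f ω ∂P
      set T := transport P τ f y
      have e : 4 * ((I + A) * T) / n = 4 * (I * T / n) + 4 * (A / n * T) := by ring
      rw [e]
      nlinarith
    have h' : Gamma P τ V y ^ 2 / n ≤ Gamma P τ (fun ω => c + V ω / n) y ^ 2 -
        Gamma P τ (fun _ => c) y ^ 2 := by linarith
    rw [div_le_iff₀ hn'] at h'
    linarith
  · have e := ecV _ (memF_one_s16 hX)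
    rw [I1, zero_add] at e
    simp only [mul_one] at e
    have h := Gamma_sq_le (fun ω => c + V ω / n) y (memF_one_s16 hX) (by rw [T1, e]; positivity)
    rw [T1, e] at h
    have h2 : Gamma P τ (fun ω => c + V ω / n) y ^ 2 - Gamma P τ (fun _ => c) y ^ 2 ≤
        2 * ((∫ ω, V ω ∂P) / n) * ‖y‖ ^ 2 := by linarith
    refine (mul_le_mul_of_nonneg_left h2 hn'.le).trans (le_of_eq ?_)
    field_simp
end

section
/- Let X = X^{𝕋^d} be the d-dimensional torus dynamical system (Ω = 𝕋^d = ℝ^d/ℤ^d with Borel σ-algebra, ℙ = Lebesgue measure, τ_x ω = ω + x mod 1). Let V_n, n ∈ ℕ, and V be potentials with n·V_n → V in L¹ as n → ∞ and V bounded, and let c ≥ 0. Then for every y ∈ ℝ^d, n·(Γ_{V_n+c}(y)² − Γ_c(y)²) → 2𝔼[V]·|y|² as n → ∞. -/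
open MeasureTheory Filter

/-- The shift action of `ℝ^d` on the `d`-dimensional torus `𝕋^d = (ℝ/ℤ)^d`. -/
noncomputable def torusShift (d : ℕ) : Rd d → (Fin d → AddCircle (1 : ℝ)) → (Fin d → AddCircle (1 : ℝ)) :=
  fun x ω i => ω i + (x i : ℝ)

namespace TorusRate

abbrev T (d : ℕ) := Fin d → AddCircle (1 : ℝ)

instance probT (d : ℕ) : IsProbabilityMeasure (volume : Measure (T d)) := by
  have : IsProbabilityMeasure (volume : Measure (AddCircle (1 : ℝ))) :=
    ⟨by rw [AddCircle.measure_univ]; simp⟩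
  exact inferInstanceAs (IsProbabilityMeasure
    (Measure.pi fun _ : Fin d => (volume : Measure (AddCircle (1 : ℝ)))))

theorem shift_cont (d : ℕ) : Continuous (fun p : T d × Rd d => torusShift d p.2 p.1) := by
  unfold torusShift
  refine continuous_pi fun i => ?_
  have h : Continuous (fun r : ℝ => (r : AddCircle (1:ℝ))) := AddCircle.continuous_mk' 1
  have h2 : Continuous fun p : T d × Rd d => p.2 i := by fun_prop
  exact ((continuous_apply i).comp continuous_fst).add (h.comp h2)

theorem shift_add {d : ℕ} (x z : Rd d) (ω : T d) :
    torusShift d (x + z) ω = torusShift d z (torusShift d x ω) := by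
  funext i
  simp [torusShift, add_assoc]

theorem shift_zero {d : ℕ} (ω : T d) : torusShift d 0 ω = ω := by
  funext i
  simp [torusShift]

theorem shift_mp {d : ℕ} (x : Rd d) :
    MeasurePreserving (torusShift d x) (volume : Measure (T d)) volume :=
  measurePreserving_add_right (volume : Measure (T d)) (fun i => ((x i : ℝ) : AddCircle (1:ℝ)))

theorem cont_of_realise {d : ℕ} {E : Type*} [TopologicalSpace E] (f : T d → E)
    (h : Continuous (realise (torusShift d) f 0)) : Continuous f := by
  have hq : IsOpenQuotientMap (Pi.map (fun (_ : Fin d) (r : ℝ) => (r : AddCircle (1:ℝ)))) :=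
    IsOpenQuotientMap.piMap (fun _ => QuotientAddGroup.isOpenQuotientMap_mk)
  rw [hq.isQuotientMap.continuous_iff]
  have := h.comp (PiLp.continuous_toLp 2 (fun _ : Fin d => ℝ))
  convert this using 1
  funext x
  simp only [Function.comp, realise]
  congr 1
  funext i
  simp [torusShift]

theorem exists_lift {d : ℕ} (η : T d) :
    ∃ x : Rd d, ‖x‖ ≤ Real.sqrt d ∧ ∀ ω, torusShift d x ω = ω + η := by
  have : ∀ i, ∃ r : ℝ, |r| ≤ 1 ∧ (r : AddCircle (1:ℝ)) = η i := by
    intro i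
    refine ⟨(AddCircle.equivIco 1 0 (η i) : ℝ), ?_, ?_⟩
    · have := (AddCircle.equivIco 1 0 (η i)).2
      rw [abs_le]
      constructor <;> linarith [this.1, this.2]
    · exact (AddCircle.equivIco 1 0).symm_apply_apply (η i)
  choose r hr hη using this
  refine ⟨WithLp.toLp 2 r, ?_, ?_⟩
  · rw [EuclideanSpace.norm_eq]
    apply Real.sqrt_le_sqrt
    calc ∑ i, ‖r i‖ ^ 2 ≤ ∑ _i : Fin d, (1:ℝ) :=
          Finset.sum_le_sum fun i _ => by
            rw [Real.norm_eq_abs]; exact pow_le_one₀ (abs_nonneg _) (hr i)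
      _ = d := by simp
  · intro ω
    funext i
    simp [torusShift, hη]

/-- gradient of a function on the torus -/
noncomputable def G {d : ℕ} (f : T d → ℝ) (ω : T d) : Rd d →L[ℝ] ℝ :=
  fderiv ℝ (realise (torusShift d) f ω) 0

theorem G_meas {d : ℕ} {f : T d → ℝ} (hf : Continuous f) : Measurable (G f) := by
  have h : Continuous (Function.uncurry (fun (ω : T d) (x : Rd d) => realise (torusShift d) f ω x)) :=
    hf.comp (shift_cont d)
  exact (measurable_fderiv_with_param ℝ h).comp (measurable_id.prodMk measurable_const)

theorem fderiv_realise {d : ℕ} (f : T d → ℝ) (ω : T d) (z : Rd d) :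
    fderiv ℝ (realise (torusShift d) f ω) z = G f (torusShift d z ω) := by
  have : realise (torusShift d) f (torusShift d z ω)
      = fun x => realise (torusShift d) f ω (z + x) := by
    funext x
    simp [realise, shift_add]
  rw [G, this, fderiv_comp_add_left, add_zero]

theorem poincare_step {d : ℕ} {f : T d → ℝ} (hs : ∀ ω, ContDiff ℝ 1 (realise (torusShift d) f ω))
    {C : ℝ} (hC : ∀ ω, ‖G f ω‖ ≤ C) (x : Rd d) :
    ∫ ω, |f (torusShift d x ω) - f ω| ≤ ‖x‖ * ∫ ω, ‖G f ω‖ := by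
  have hf : Continuous f := cont_of_realise f (hs 0).continuous
  have hGm : Measurable fun ω => ‖G f ω‖ := (G_meas hf).norm
  have hsc : Continuous fun p : T d × ℝ => torusShift d (p.2 • x) p.1 :=
    (shift_cont d).comp (continuous_fst.prodMk (continuous_snd.smul continuous_const))
  have hj : Measurable fun p : T d × ℝ => ‖G f (torusShift d (p.2 • x) p.1)‖ :=
    hGm.comp hsc.measurable
  have hint : Integrable (fun p : T d × ℝ => ‖G f (torusShift d (p.2 • x) p.1)‖)
      ((volume : Measure (T d)).prod (volume.restrict (Set.Ioc (0:ℝ) 1))) :=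
    Integrable.of_bound hj.aestronglyMeasurable C
      (Filter.Eventually.of_forall fun p => by simpa using hC _)
  have hpt : ∀ ω, |f (torusShift d x ω) - f ω|
      ≤ ‖x‖ * ∫ t in Set.Ioc (0:ℝ) 1, ‖G f (torusShift d (t • x) ω)‖ := by
    intro ω
    have hder : ∀ t : ℝ, HasDerivAt (fun t : ℝ => realise (torusShift d) f ω (t • x))
        (fderiv ℝ (realise (torusShift d) f ω) (t • x) x) t := by
      intro t
      have h1 := (((hs ω).differentiable one_ne_zero) (t • x)).hasFDerivAt
      have h2 : HasDerivAt (fun t : ℝ => t • x) x t := by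
        simpa using (hasDerivAt_id t).smul_const x
      exact h1.comp_hasDerivAt t h2
    have hcd : Continuous fun t : ℝ => fderiv ℝ (realise (torusShift d) f ω) (t • x) :=
      ((hs ω).continuous_fderiv one_ne_zero).comp (continuous_id.smul continuous_const)
    have hc : Continuous fun t : ℝ => fderiv ℝ (realise (torusShift d) f ω) (t • x) x :=
      hcd.clm_apply continuous_const
    have ftc := intervalIntegral.integral_eq_sub_of_hasDerivAt (a := 0) (b := 1)
      (fun t _ => hder t) (hc.intervalIntegrable _ _)
    simp only [realise, one_smul, zero_smul, shift_zero] at ftc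
    rw [← ftc, ← Real.norm_eq_abs]
    refine (intervalIntegral.norm_integral_le_integral_norm zero_le_one).trans ?_
    rw [intervalIntegral.integral_of_le zero_le_one, ← integral_const_mul]
    refine integral_mono ?_ ?_ ?_
    · exact (hc.norm.intervalIntegrable 0 1).1
    · have := ((continuous_const (y := ‖x‖)).mul hcd.norm).intervalIntegrable (μ := volume) 0 1
      have := this.1
      simp_rw [fderiv_realise] at this
      exact this
    · intro t
      have := (fderiv ℝ (realise (torusShift d) f ω) (t • x)).le_opNorm x
      rw [fderiv_realise, mul_comm] at this
      have e := fderiv_realise f ω (t • x)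
      simp only at e this ⊢
      rw [e]
      exact this
  calc ∫ ω, |f (torusShift d x ω) - f ω|
      ≤ ∫ ω, ‖x‖ * ∫ t in Set.Ioc (0:ℝ) 1, ‖G f (torusShift d (t • x) ω)‖ := by
        refine integral_mono_of_nonneg (Filter.Eventually.of_forall fun _ => abs_nonneg _) ?_
          (Filter.Eventually.of_forall hpt)
        exact hint.integral_prod_left.const_mul _
    _ = ‖x‖ * ∫ ω, ∫ t in Set.Ioc (0:ℝ) 1, ‖G f (torusShift d (t • x) ω)‖ :=
        integral_const_mul _ _
    _ = ‖x‖ * ∫ t in Set.Ioc (0:ℝ) 1, ∫ ω, ‖G f (torusShift d (t • x) ω)‖ := by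
        rw [integral_integral_swap hint]
    _ = ‖x‖ * ∫ t in Set.Ioc (0:ℝ) 1, ∫ ω, ‖G f ω‖ := by
        congr 1
        refine integral_congr_ae (Filter.Eventually.of_forall fun t => ?_)
        have := (shift_mp (t • x)).map_eq
        conv_rhs => rw [← this]
        exact (integral_map (shift_mp (t • x)).measurable.aemeasurable
          hGm.aestronglyMeasurable).symm
    _ = _ := by simp

theorem poincare {d : ℕ} {f : T d → ℝ} (hs : ∀ ω, ContDiff ℝ 1 (realise (torusShift d) f ω))
    {C : ℝ} (hC : ∀ ω, ‖G f ω‖ ≤ C) {B : ℝ} (hB : ∀ ω, |f ω| ≤ B) (h1 : ∫ ω, f ω = 1) :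
    ∫ ω, |f ω - 1| ≤ Real.sqrt d * ∫ ω, ‖G f ω‖ := by
  have hf : Continuous f := cont_of_realise f (hs 0).continuous
  have hfi : Integrable f := Integrable.of_bound hf.aestronglyMeasurable B
      (Filter.Eventually.of_forall fun p => by simpa using hB _)
  have hmp (ω : T d) : MeasurePreserving (fun η : T d => ω + η) volume volume :=
    measurePreserving_add_left volume ω
  have hK : Continuous fun p : T d × T d => |f (p.1 + p.2) - f p.1| := by fun_prop
  have hint : Integrable (fun p : T d × T d => |f (p.1 + p.2) - f p.1|)
      ((volume : Measure (T d)).prod volume) :=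
    Integrable.of_bound hK.aestronglyMeasurable (B + B)
      (Filter.Eventually.of_forall fun p => by
        rw [Real.norm_eq_abs, abs_abs]
        exact (abs_sub _ _).trans (add_le_add (hB _) (hB _)))
  have hpt : ∀ ω, |f ω - 1| ≤ ∫ η, |f (ω + η) - f ω| := by
    intro ω
    have hi : Integrable (fun η => f (ω + η)) := (hmp ω).integrable_comp_of_integrable hfi
    have : ∫ η, (f (ω + η) - f ω) = 1 - f ω := by
      rw [integral_sub hi (integrable_const _), integral_add_left_eq_self f ω, h1]
      simp
    rw [abs_sub_comm, ← this]
    exact abs_integral_le_integral_abs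
  calc ∫ ω, |f ω - 1| ≤ ∫ ω, ∫ η, |f (ω + η) - f ω| :=
        integral_mono_of_nonneg (Filter.Eventually.of_forall fun _ => abs_nonneg _)
          hint.integral_prod_left (Filter.Eventually.of_forall hpt)
    _ = ∫ η, ∫ ω, |f (ω + η) - f ω| := integral_integral_swap hint
    _ ≤ ∫ η : T d, Real.sqrt d * ∫ ω, ‖G f ω‖ := by
        refine integral_mono_of_nonneg
          (Filter.Eventually.of_forall fun _ => integral_nonneg fun _ => abs_nonneg _)
          (integrable_const _) (Filter.Eventually.of_forall fun η => ?_)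
        obtain ⟨x, hx, hxe⟩ := exists_lift η
        have := poincare_step hs hC x
        simp only [hxe] at this
        exact this.trans (mul_le_mul_of_nonneg_right hx (integral_nonneg fun _ => norm_nonneg _))
    _ = _ := by simp

theorem memF_bounds {d : ℕ} {f : T d → ℝ} (hf : memF volume (torusShift d) f) :
    (∃ B, ∀ ω, |f ω| ≤ B) ∧ (∃ C, ∀ ω, ‖G f ω‖ ≤ C) ∧
      (∀ ω, ContDiff ℝ 1 (realise (torusShift d) f ω)) := by
  obtain ⟨-, -, -, -, hs, hb⟩ := hf
  refine ⟨?_, ?_, fun ω => (hs ω).of_le (by exact_mod_cast le_top)⟩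
  · obtain ⟨B, hB⟩ := hb 0
    refine ⟨B, fun ω => ?_⟩
    have := hB ω
    rw [norm_iteratedFDeriv_zero] at this
    simpa [realise, shift_zero] using this
  · obtain ⟨C, hC⟩ := hb 1
    refine ⟨C, fun ω => ?_⟩
    have := hC ω
    rwa [norm_iteratedFDeriv_one] at this

theorem grad_integrable {d : ℕ} {f : T d → ℝ} (hf : memF volume (torusShift d) f) :
    Integrable (fun ω => ‖G f ω‖) ∧ Integrable (fun ω => ‖G f ω‖ ^ 2 / (8 * f ω)) := by
  obtain ⟨-, ⟨C, hC⟩, hs⟩ := memF_bounds hf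
  have hcf : Continuous f := cont_of_realise f (hs 0).continuous
  have hGm : Measurable fun ω => ‖G f ω‖ := (G_meas hcf).norm
  obtain ⟨-, -, -, ⟨b, hb0, hb⟩, -, -⟩ := hf
  constructor
  · exact Integrable.of_bound hGm.aestronglyMeasurable C
      (Filter.Eventually.of_forall fun ω => by simpa using hC ω)
  · refine Integrable.of_bound ((hGm.pow_const 2).div
      (hcf.measurable.const_mul 8)).aestronglyMeasurable (C ^ 2 / (8 * b))
      (Filter.Eventually.of_forall fun ω => ?_)
    have h0 := hb ω
    have hfp : 0 < f ω := by linarith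
    rw [Real.norm_of_nonneg (by positivity)]
    have := hC ω
    gcongr

theorem mul_integrable {d : ℕ} {f U : T d → ℝ} (hf : memF volume (torusShift d) f)
    (hU : Integrable U) : Integrable (fun ω => U ω * f ω) := by
  obtain ⟨⟨B, hB⟩, -, hs⟩ := memF_bounds hf
  exact hU.mul_bdd (c := B) hf.1.aestronglyMeasurable (Filter.Eventually.of_forall fun ω => hB ω)

theorem energy_lower {d : ℕ} {f U W : T d → ℝ} (hf : memF volume (torusShift d) f)
    (hU : Integrable U) (hW : Integrable W) (hW0 : ∀ ω, 0 ≤ W ω) {M : ℝ} (hM : ∀ ω, W ω ≤ M)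
    (c : ℝ) {n : ℝ} (hn : 0 < n) (hWU : ∀ ω, W ω ≤ n * U ω) :
    n * c + (∫ ω, W ω) - 2 * M ^ 2 * d / n
      ≤ n * energy volume (torusShift d) (fun ω => U ω + c) f := by
  obtain ⟨⟨B, hB⟩, ⟨C, hC⟩, hs⟩ := memF_bounds hf
  obtain ⟨hg1, hg2⟩ := grad_integrable hf
  have hP := poincare hs hC hB hf.2.2.1
  have hM0 : 0 ≤ M := (hW0 0).trans (hM 0)
  have hfi := hf.2.1
  have hpos : ∀ ω, 0 < f ω := by
    obtain ⟨b, hb0, hb⟩ := hf.2.2.2.1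
    exact fun ω => hb0.trans_le (hb ω)
  set a := Real.sqrt d with ha
  have ha2 : a ^ 2 = d := Real.sq_sqrt (Nat.cast_nonneg d)
  have habs : Integrable (fun ω => |f ω - 1|) := (hfi.sub (integrable_const 1)).abs
  have hUc : Integrable (fun ω => (U ω + c) * f ω) :=
    mul_integrable hf (hU.add (integrable_const c))
  have hE : energy volume (torusShift d) (fun ω => U ω + c) f
      = ∫ ω, (‖G f ω‖ ^ 2 / (8 * f ω) + (U ω + c) * f ω) := rfl
  have hL : ∫ ω, (((M * a) * ‖G f ω‖ - (2 * M ^ 2 * a ^ 2 / n) * f ω) + (n * c) * f ω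
        + (W ω - M * |f ω - 1|))
      = ((M * a) * ∫ ω, ‖G f ω‖) - (2 * M ^ 2 * a ^ 2 / n) + n * c
        + ((∫ ω, W ω) - M * ∫ ω, |f ω - 1|) := by
    have i1 := hg1.const_mul (M * a)
    have i2 := hfi.const_mul (2 * M ^ 2 * a ^ 2 / n)
    have i3 := hfi.const_mul (n * c)
    have i4 := habs.const_mul M
    have i12 : Integrable (fun ω => (M * a) * ‖G f ω‖ - (2 * M ^ 2 * a ^ 2 / n) * f ω) := i1.sub i2
    have i123 : Integrable (fun ω => ((M * a) * ‖G f ω‖ - (2 * M ^ 2 * a ^ 2 / n) * f ω)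
      + (n * c) * f ω) := i12.add i3
    have i5 : Integrable (fun ω => W ω - M * |f ω - 1|) := hW.sub i4
    rw [integral_add i123 i5, integral_add i12 i3,
      integral_sub i1 i2, integral_sub hW i4]
    simp only [integral_const_mul, hf.2.2.1, mul_one]
  have hmono : ∫ ω, (((M * a) * ‖G f ω‖ - (2 * M ^ 2 * a ^ 2 / n) * f ω) + (n * c) * f ω
        + (W ω - M * |f ω - 1|))
      ≤ ∫ ω, n * (‖G f ω‖ ^ 2 / (8 * f ω) + (U ω + c) * f ω) := by
    refine integral_mono ((((hg1.const_mul (M * a)).sub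
      (hfi.const_mul (2 * M ^ 2 * a ^ 2 / n))).add (hfi.const_mul (n * c))).add
      (hW.sub (habs.const_mul M))) ((hg2.add hUc).const_mul n) fun ω => ?_
    have hp := hpos ω
    have e1 : (M * a) * ‖G f ω‖ - (2 * M ^ 2 * a ^ 2 / n) * f ω
        ≤ n * (‖G f ω‖ ^ 2 / (8 * f ω)) := by
      have : n * (‖G f ω‖ ^ 2 / (8 * f ω)) -
          ((M * a) * ‖G f ω‖ - (2 * M ^ 2 * a ^ 2 / n) * f ω)
          = (n * ‖G f ω‖ - 4 * M * a * f ω) ^ 2 / (8 * n * f ω) := by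
        field_simp
        ring
      have h2 : 0 ≤ (n * ‖G f ω‖ - 4 * M * a * f ω) ^ 2 / (8 * n * f ω) := by positivity
      linarith
    have e2 : W ω - M * |f ω - 1| ≤ n * U ω * f ω := by
      have h1 : W ω * f ω ≤ n * U ω * f ω := mul_le_mul_of_nonneg_right (hWU ω) hp.le
      have h2 : W ω * (1 - f ω) ≤ M * |f ω - 1| := by
        rw [abs_sub_comm]
        exact (mul_le_mul_of_nonneg_left (le_abs_self _) (hW0 ω)).trans
          (mul_le_mul_of_nonneg_right (hM ω) (abs_nonneg _))
      linarith
    simp only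
    linarith
  rw [hE, ← integral_const_mul]
  refine le_trans ?_ hmono
  rw [hL, ha2]
  have := mul_le_mul_of_nonneg_left hP hM0
  linarith

theorem transport_lower_pt {d : ℕ} {f : T d → ℝ} (hf : memF volume (torusShift d) f) (y : Rd d)
    {φ : T d → Rd d} (hφ : memPhi volume (torusShift d) y φ) :
    ‖y‖ ^ 2 / 2 ≤ ∫ ω, ‖φ ω‖ ^ 2 / (2 * f ω) := by
  obtain ⟨hm, hi, hy, -, hb, -⟩ := hφ
  obtain ⟨b, hb0, hbf⟩ := hf.2.2.2.1
  obtain ⟨C, hC'⟩ := hb 0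
  have hC : ∀ ω, ‖φ ω‖ ≤ C := fun ω => by
    have := hC' ω
    rw [norm_iteratedFDeriv_zero] at this
    simpa [realise, shift_zero] using this
  have hI : Integrable (fun ω => ‖φ ω‖ ^ 2 / (2 * f ω)) := by
    refine Integrable.of_bound ((hm.norm.pow_const 2).div
      (hf.1.const_mul 2)).aestronglyMeasurable (C ^ 2 / (2 * b))
      (Filter.Eventually.of_forall fun ω => ?_)
    have h0 := hbf ω
    have hfp : 0 < f ω := by linarith
    rw [Real.norm_of_nonneg (by positivity)]
    have := hC ω
    gcongr
  have hin : Integrable (fun ω => inner ℝ y (φ ω)) := hi.const_inner y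
  have hL : ∫ ω, (inner ℝ y (φ ω) - (‖y‖ ^ 2 / 2) * f ω) = ‖y‖ ^ 2 / 2 := by
    rw [integral_sub hin (hf.2.1.const_mul _), integral_const_mul, hf.2.2.1, integral_inner hi, hy,
      real_inner_self_eq_norm_sq]
    ring
  rw [← hL]
  refine integral_mono (hin.sub (hf.2.1.const_mul _)) hI fun ω => ?_
  have hp : 0 < f ω := hb0.trans_le (hbf ω)
  have hcs : inner ℝ y (φ ω) ≤ ‖y‖ * ‖φ ω‖ := real_inner_le_norm _ _
  have : ‖φ ω‖ ^ 2 / (2 * f ω) - (‖y‖ * ‖φ ω‖ - (‖y‖ ^ 2 / 2) * f ω)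
      = (‖φ ω‖ - ‖y‖ * f ω) ^ 2 / (2 * f ω) := by
    field_simp
    ring
  have h2 : 0 ≤ (‖φ ω‖ - ‖y‖ * f ω) ^ 2 / (2 * f ω) := by positivity
  simp only
  linarith

theorem const_memPhi {d : ℕ} (y : Rd d) :
    memPhi volume (torusShift d) y (fun _ : T d => y) := by
  refine ⟨measurable_const, integrable_const _, by simp, fun ω => ?_, fun n => ⟨‖iteratedFDeriv ℝ n
    (fun _ : Rd d => y) 0‖, fun ω => le_rfl⟩, fun ω x => ?_⟩
  · exact contDiff_const
  · simp [realise]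

theorem one_memF {d : ℕ} : memF volume (torusShift d) (fun _ : T d => (1 : ℝ)) := by
  refine ⟨measurable_const, integrable_const _, by simp, ⟨1, one_pos, fun _ => le_rfl⟩,
    fun ω => ?_, fun n => ⟨‖iteratedFDeriv ℝ n (fun _ : Rd d => (1:ℝ)) 0‖, fun ω => le_rfl⟩⟩
  exact contDiff_const

theorem transport_lower {d : ℕ} {f : T d → ℝ} (hf : memF volume (torusShift d) f) (y : Rd d) :
    ‖y‖ ^ 2 / 2 ≤ transport volume (torusShift d) f y := by
  refine le_csInf ⟨_, _, const_memPhi y, rfl⟩ ?_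
  rintro r ⟨φ, hφ, rfl⟩
  exact transport_lower_pt hf y hφ

theorem transport_one {d : ℕ} (y : Rd d) :
    transport volume (torusShift d) (fun _ : T d => (1 : ℝ)) y ≤ ‖y‖ ^ 2 / 2 := by
  refine csInf_le ⟨0, ?_⟩ ⟨_, const_memPhi y, by simp⟩
  rintro r ⟨φ, hφ, rfl⟩
  exact integral_nonneg fun ω => by simp only; positivity

theorem energy_one {d : ℕ} (U : T d → ℝ) :
    energy volume (torusShift d) U (fun _ => 1) = ∫ ω, U ω := by
  have : ∀ ω : T d, realise (torusShift d) (fun _ : T d => (1:ℝ)) ω = fun _ => 1 := fun _ => rfl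
  simp [energy, this]

theorem Gamma_upper {d : ℕ} {U : T d → ℝ} (hU : ∀ ω, 0 ≤ U ω) (y : Rd d) :
    Gamma volume (torusShift d) U y ^ 2 ≤ 2 * (∫ ω, U ω) * ‖y‖ ^ 2 := by
  have hi : 0 ≤ ∫ ω, U ω := integral_nonneg hU
  set S := sInf {r | ∃ f, memF volume (torusShift d) f ∧
    r = Real.sqrt (energy volume (torusShift d) U f * transport volume (torusShift d) f y)} with hS
  have h0 : 0 ≤ S := by
    refine Real.sInf_nonneg ?_
    rintro r ⟨f, -, rfl⟩
    exact Real.sqrt_nonneg _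
  have h1 : S ≤ Real.sqrt ((∫ ω, U ω) * (‖y‖ ^ 2 / 2)) := by
    rw [hS]
    refine le_trans (csInf_le ⟨0, ?_⟩ ⟨_, one_memF, rfl⟩) ?_
    · rintro r ⟨f, -, rfl⟩
      exact Real.sqrt_nonneg _
    · rw [energy_one]
      exact Real.sqrt_le_sqrt (mul_le_mul_of_nonneg_left (transport_one y) hi)
  have h2 : S ^ 2 ≤ (∫ ω, U ω) * (‖y‖ ^ 2 / 2) := by
    rw [← Real.sq_sqrt (by positivity : 0 ≤ (∫ ω, U ω) * (‖y‖ ^ 2 / 2))]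
    exact pow_le_pow_left₀ h0 h1 2
  have : Gamma volume (torusShift d) U y = 2 * S := rfl
  rw [this]
  nlinarith

theorem Gamma_lower {d : ℕ} {U : T d → ℝ} (y : Rd d) {L : ℝ}
    (hL : ∀ f, memF volume (torusShift d) f → L ≤ energy volume (torusShift d) U f) :
    2 * L * ‖y‖ ^ 2 ≤ Gamma volume (torusShift d) U y ^ 2 := by
  rcases le_or_gt 0 L with h | h
  · set S := sInf {r | ∃ f, memF volume (torusShift d) f ∧
      r = Real.sqrt (energy volume (torusShift d) U f * transport volume (torusShift d) f y)}
      with hS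
    have h1 : Real.sqrt (L * (‖y‖ ^ 2 / 2)) ≤ S := by
      refine le_csInf ⟨_, _, one_memF, rfl⟩ ?_
      rintro r ⟨f, hf, rfl⟩
      exact Real.sqrt_le_sqrt (mul_le_mul (hL f hf) (transport_lower hf y) (by positivity)
        (h.trans (hL f hf)))
    have h2 : L * (‖y‖ ^ 2 / 2) ≤ S ^ 2 := by
      rw [← Real.sq_sqrt (by positivity : 0 ≤ L * (‖y‖ ^ 2 / 2))]
      exact pow_le_pow_left₀ (Real.sqrt_nonneg _) h1 2
    have : Gamma volume (torusShift d) U y = 2 * S := rfl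
    rw [this]
    nlinarith
  · nlinarith [sq_nonneg (Gamma volume (torusShift d) U y), sq_nonneg ‖y‖]

theorem Gamma_const {d : ℕ} (y : Rd d) {c : ℝ} (hc : 0 ≤ c) :
    Gamma volume (torusShift d) (fun _ => c) y ^ 2 = 2 * c * ‖y‖ ^ 2 := by
  apply le_antisymm
  · simpa using Gamma_upper (U := fun _ : T d => c) (fun _ => hc) y
  · refine Gamma_lower y fun f hf => ?_
    have := energy_lower (U := fun _ => 0) (W := fun _ => 0) (M := 0) hf (integrable_zero _ _ _)
      (integrable_zero _ _ _) (fun _ => le_rfl) (fun _ => le_rfl) c one_pos (fun _ => by simp)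
    simpa using this

end TorusRate

/-- exact rate of convergence on the `d`-dimensional torus:
`n(Γ_{V_n+c}(y)² − Γ_c(y)²) → 2𝔼[V]|y|²` when `nV_n → V` in `L¹` and `V` is bounded. -/
theorem gamma_torus_rate {d : ℕ}
    (Vs : ℕ → (Fin d → AddCircle (1 : ℝ)) → ℝ) (V : (Fin d → AddCircle (1 : ℝ)) → ℝ)
    (hVs : ∀ n, IsPotential volume (Vs n)) (hV : IsPotential volume V)
    (hL1 : Filter.Tendsto (fun n : ℕ => ∫ ω, |(n : ℝ) * Vs n ω - V ω|) Filter.atTop (nhds 0))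
    (hVb : ∃ M, ∀ ω, V ω ≤ M) (c : ℝ) (hc : 0 ≤ c) (y : Rd d) :
    Filter.Tendsto
      (fun n : ℕ => (n : ℝ) *
        ((Gamma volume (torusShift d) (fun ω => Vs n ω + c) y) ^ 2 -
          (Gamma volume (torusShift d) (fun _ => c) y) ^ 2))
      Filter.atTop (nhds (2 * (∫ ω, V ω) * ‖y‖ ^ 2)) := by
  obtain ⟨M, hM⟩ := hVb
  set I : ℕ → ℝ := fun n => ∫ ω, |(n : ℝ) * Vs n ω - V ω| with hI
  have hdi : ∀ n : ℕ, Integrable (fun ω => |(n : ℝ) * Vs n ω - V ω|) := fun n =>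
    (((hVs n).2.2.const_mul _).sub hV.2.2).abs
  have hup : ∀ n : ℕ, (n : ℝ) *
        ((Gamma volume (torusShift d) (fun ω => Vs n ω + c) y) ^ 2 -
          (Gamma volume (torusShift d) (fun _ => c) y) ^ 2)
      ≤ 2 * ((∫ ω, V ω) + I n) * ‖y‖ ^ 2 := by
    intro n
    have h1 := TorusRate.Gamma_upper (U := fun ω => Vs n ω + c)
      (fun ω => add_nonneg ((hVs n).2.1 ω) hc) y
    rw [integral_add (hVs n).2.2 (integrable_const c)] at h1
    simp only [integral_const, probReal_univ, smul_eq_mul, one_mul] at h1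
    rw [TorusRate.Gamma_const y hc]
    have h2 : (n : ℝ) * ∫ ω, Vs n ω ≤ (∫ ω, V ω) + I n := by
      rw [← integral_const_mul, hI, ← integral_add hV.2.2 (hdi n)]
      refine integral_mono ((hVs n).2.2.const_mul _) (hV.2.2.add (hdi n)) fun ω => ?_
      have := le_abs_self ((n : ℝ) * Vs n ω - V ω)
      simp only
      linarith
    have h3 := mul_le_mul_of_nonneg_left h1 (Nat.cast_nonneg (α := ℝ) n)
    have h4 := mul_le_mul_of_nonneg_right h2 (sq_nonneg ‖y‖)
    linarith
  have hlow : ∀ n : ℕ, 0 < n → 2 * ((∫ ω, V ω) - I n - 2 * M ^ 2 * d / n) * ‖y‖ ^ 2 ≤ (n : ℝ) *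
        ((Gamma volume (torusShift d) (fun ω => Vs n ω + c) y) ^ 2 -
          (Gamma volume (torusShift d) (fun _ => c) y) ^ 2) := by
    intro n hn
    have hn' : (0 : ℝ) < n := Nat.cast_pos.mpr hn
    have hWi : Integrable (fun ω => min ((n : ℝ) * Vs n ω) (V ω)) :=
      ((hVs n).2.2.const_mul _).inf hV.2.2
    have hW : (∫ ω, V ω) - I n ≤ ∫ ω, min ((n : ℝ) * Vs n ω) (V ω) := by
      rw [hI, ← integral_sub hV.2.2 (hdi n)]
      refine integral_mono (hV.2.2.sub (hdi n)) hWi fun ω => ?_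
      refine le_min ?_ ?_
      · have := neg_abs_le ((n : ℝ) * Vs n ω - V ω)
        simp only
        linarith
      · have := abs_nonneg ((n : ℝ) * Vs n ω - V ω)
        simp only
        linarith
    have h1 := TorusRate.Gamma_lower (U := fun ω => Vs n ω + c) y
      (L := ((n : ℝ) * c + ((∫ ω, V ω) - I n) - 2 * M ^ 2 * d / n) / n) (fun f hf => by
        rw [div_le_iff₀' hn']
        have := TorusRate.energy_lower hf (hVs n).2.2 hWi
          (fun ω => le_min (mul_nonneg hn'.le ((hVs n).2.1 ω)) (hV.2.1 ω))
          (fun ω => (min_le_right _ _).trans (hM ω)) c hn' (fun ω => min_le_left _ _)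
        linarith)
    have h3 := mul_le_mul_of_nonneg_left h1 hn'.le
    rw [TorusRate.Gamma_const y hc]
    have h5 : (n : ℝ) * (2 * (((n : ℝ) * c + ((∫ ω, V ω) - I n) - 2 * M ^ 2 * d / n) / n) * ‖y‖ ^ 2)
        = 2 * ((n : ℝ) * c + ((∫ ω, V ω) - I n) - 2 * M ^ 2 * d / n) * ‖y‖ ^ 2 := by
      generalize ((n : ℝ) * c + ((∫ ω, V ω) - I n) - 2 * M ^ 2 * d / n) = z
      field_simp
    rw [h5] at h3
    linarith
  have hinv : Tendsto (fun n : ℕ => 2 * M ^ 2 * d / (n : ℝ)) atTop (nhds 0) :=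
    tendsto_const_div_atTop_nhds_zero_nat _
  refine tendsto_of_tendsto_of_tendsto_of_le_of_le'
    (g := fun n : ℕ => 2 * ((∫ ω, V ω) - I n - 2 * M ^ 2 * d / n) * ‖y‖ ^ 2)
    (h := fun n : ℕ => 2 * ((∫ ω, V ω) + I n) * ‖y‖ ^ 2) ?_ ?_ ?_ (Eventually.of_forall hup)
  · have := (((tendsto_const_nhds (x := ∫ ω, V ω)).sub hL1).sub hinv).const_mul 2
    simpa using this.mul_const (‖y‖ ^ 2)
  · have := ((tendsto_const_nhds (x := ∫ ω, V ω)).add hL1).const_mul 2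
    simpa using this.mul_const (‖y‖ ^ 2)
  · filter_upwards [eventually_gt_atTop 0] with n hn using hlow n hn
end
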